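/- arXiv:2204.14086 — 12 statements merged into one kernel-verified Lean document; each statement's English description precedes it below -/
import Mathlib

section
/- There exists an absolute constant C such that for every integer k ≥ 1 and every connected weighted graph G on n vertices with positive edge weights, there exists a (2k−1)-spanner H of G with at most C·k·n^{1+1/k} edges. -/
open SimpleGraph

/-- Weighted shortest-path distance in a graph `G` with edge weights `w`
(`⊤` if `u` and `v` are not connected). -/
noncomputable def wdist {V : Type*} (G : SimpleGraph V) (w : Sym2 V → NNReal) (u v : V) :
    ENNReal :=
  ⨅ p : G.Walk u v, ((p.edges.map w).sum : ENNReal)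

/-- `H` is an `α`-spanner of the weighted graph `(G, w)`: `H` is a subgraph of `G` and
all pairwise distances are stretched by a factor of at most `α`. -/
def IsSpanner {V : Type*} (G H : SimpleGraph V) (w : Sym2 V → NNReal) (α : ℝ) : Prop :=
  H ≤ G ∧ ∀ u v : V, wdist H w u v ≤ ENNReal.ofReal α * wdist G w u v

theorem wdist_le_sum {V : Type*} {G : SimpleGraph V} (w : Sym2 V → NNReal) {u v : V}
    (p : G.Walk u v) : wdist G w u v ≤ ((p.edges.map w).sum : NNReal) :=
  iInf_le _ p

theorem wdist_self {V : Type*} (G : SimpleGraph V) (w : Sym2 V → NNReal) (u : V) :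
    wdist G w u u = 0 := by
  simpa using wdist_le_sum w (Walk.nil : G.Walk u u)

theorem wdist_triangle {V : Type*} (G : SimpleGraph V) (w : Sym2 V → NNReal) (a b c : V) :
    wdist G w a c ≤ wdist G w a b + wdist G w b c := by
  unfold wdist
  refine ENNReal.le_iInf_add_iInf fun p q => ?_
  refine (iInf_le _ (p.append q)).trans (le_of_eq ?_)
  simp [Walk.edges_append]

theorem wdist_comm {V : Type*} (G : SimpleGraph V) (w : Sym2 V → NNReal) (u v : V) :
    wdist G w u v = wdist G w v u := by
  have h : ∀ a b, wdist G w a b ≤ wdist G w b a := fun a b => le_iInf fun p => by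
    simpa [Walk.edges_reverse, List.sum_reverse] using wdist_le_sum w p.reverse
  exact le_antisymm (h u v) (h v u)

theorem wdist_anti {V : Type*} {G H : SimpleGraph V} (h : G ≤ H) (w : Sym2 V → NNReal) (u v : V) :
    wdist H w u v ≤ wdist G w u v := by
  refine le_iInf fun p => (wdist_le_sum w (p.mapLe h)).trans ?_
  rw [Walk.edges_mapLe_eq_edges]

theorem wdist_le_of_adj {V : Type*} {G : SimpleGraph V} (w : Sym2 V → NNReal) {u v : V}
    (h : G.Adj u v) : wdist G w u v ≤ w s(u, v) := by
  simpa using wdist_le_sum w h.toWalk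

theorem IsSpanner.of_adj {V : Type*} {G H : SimpleGraph V} {w : Sym2 V → NNReal} {α : ℝ}
    (hle : H ≤ G) (hα : 0 < α)
    (h : ∀ u v, G.Adj u v → wdist H w u v ≤ ENNReal.ofReal α * w s(u, v)) :
    IsSpanner G H w α := by
  refine ⟨hle, fun u v => ?_⟩
  rw [wdist.eq_def G, ENNReal.mul_iInf_of_ne (by simpa using hα) ENNReal.ofReal_ne_top]
  refine le_iInf fun p => ?_
  induction p with
  | nil => simp [wdist_self]
  | @cons a b c hab p ih =>
    refine (wdist_triangle H w a b c).trans ?_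
    simp only [Walk.edges_cons, List.map_cons, List.sum_cons, ENNReal.coe_add, mul_add]
    exact add_le_add (h a b hab) ih

/-- A trail splits at any of its edges into two walks avoiding that edge. -/
theorem SimpleGraph.Walk.IsTrail.exists_split_of_mem_edges {V : Type*} {G : SimpleGraph V} {x y : V}
    {p : G.Walk x y} (hp : p.IsTrail) {e : Sym2 V} (he : e ∈ p.edges) :
    ∃ (u v : V) (q : G.Walk x u) (r : G.Walk v y), s(u, v) = e ∧
      q.length + r.length + 1 = p.length ∧
      e ∉ q.edges ∧ e ∉ r.edges := by
  induction p with
  | nil => simp at he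
  | @cons a b c h p ih =>
    rw [Walk.isTrail_cons] at hp
    by_cases hab : s(a, b) = e
    · subst hab
      exact ⟨a, b, .nil, p, rfl, by simp, by simp, hp.2⟩
    · have he' : e ∈ p.edges := by
        rw [Walk.edges_cons, List.mem_cons] at he
        exact he.resolve_left (Ne.symm hab)
      obtain ⟨u, v, q, r, huv, hl, hq, hr⟩ := ih hp.1 he'
      refine ⟨u, v, .cons h q, r, huv, by simp only [Walk.length_cons]; omega, ?_, hr⟩
      simp [hq, Ne.symm hab]

/-- The greedy spanner construction, processing the edges by increasing weight, gives a graph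
of stretch `m + 1` without cycles of length at most `m + 2`. -/
theorem exists_greedy_spanner {V : Type*} [DecidableEq V] (w : Sym2 V → NNReal) (m : ℕ)
    (E : Finset (Sym2 V)) :
    ∃ F ⊆ E,
      (∀ u v, s(u, v) ∈ E →
        wdist (fromEdgeSet (F : Set (Sym2 V))) w u v ≤ (m + 1 : ℕ) * w s(u, v)) ∧
      ∀ x (c : (fromEdgeSet (F : Set (Sym2 V))).Walk x x), c.IsCycle → m + 2 < c.length := by
  induction E using Finset.induction_on_max_value w with
  | empty =>
    refine ⟨∅, by simp, by simp, fun x c hc => ?_⟩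
    obtain ⟨e, he⟩ := List.exists_mem_of_ne_nil _ (Walk.edges_eq_nil.not.2 hc.not_nil)
    simpa using c.edges_subset_edgeSet he
  | insert a s ha hmax ih =>
    obtain ⟨F, hFs, hdist, hcyc⟩ := ih
    by_cases hshort : ∀ u v, s(u, v) = a →
        wdist (fromEdgeSet (F : Set (Sym2 V))) w u v ≤ (m + 1 : ℕ) * w a
    · refine ⟨F, hFs.trans (Finset.subset_insert _ _), fun u v huv => ?_, hcyc⟩
      rcases Finset.mem_insert.1 huv with h | h
      · rw [h]
        exact hshort u v h
      · exact hdist u v h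
    · refine ⟨insert a F, Finset.insert_subset_insert _ hFs, fun u v huv => ?_, fun x c hc => ?_⟩
      · rcases Finset.mem_insert.1 huv with h | h
        · by_cases huv' : u = v
          · subst huv'
            simp [wdist_self]
          · refine (wdist_le_of_adj w (by simp [h, huv'])).trans ?_
            exact le_mul_of_one_le_left zero_le (by simp)
        · refine (wdist_anti (fromEdgeSet_mono ?_) w u v).trans (hdist u v h)
          simp
      · have key : ∀ {y z} (p : (fromEdgeSet ((insert a F : Finset (Sym2 V)) : Set (Sym2 V))).Walk y z),
            a ∉ p.edges → ∀ e ∈ p.edges, e ∈ (fromEdgeSet (F : Set (Sym2 V))).edgeSet := by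
          intro y z p hp e he
          have h1 := p.edges_subset_edgeSet he
          have h2 : e ≠ a := fun h => hp (h ▸ he)
          simp only [edgeSet_fromEdgeSet, Finset.coe_insert, Set.mem_sdiff, Set.mem_insert_iff,
            h2, false_or] at h1 ⊢
          exact h1
        by_cases hac : a ∈ c.edges
        · by_contra! hlen
          obtain ⟨u, v, q, r, huv, hl, hq, hr⟩ :=
            hc.isCircuit.isTrail.exists_split_of_mem_edges hac
          apply hshort
          have hsum : wdist (fromEdgeSet (F : Set (Sym2 V))) w v u ≤ (m + 1 : ℕ) * w a := by
            have hrq : a ∉ (r.append q).edges := by simp [Walk.edges_append, hq, hr]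
            refine (wdist_le_sum w ((r.append q).transfer _ (key _ hrq))).trans ?_
            have hle := List.sum_le_card_nsmul (((r.append q).edges).map w) (w a) (by
              intro y hy
              obtain ⟨e, he, rfl⟩ := List.mem_map.1 hy
              have := key _ hrq e he
              rw [edgeSet_fromEdgeSet] at this
              exact hmax e (hFs (by simpa using this.1)))
            rw [Walk.edges_transfer]
            have hle' : (((r.append q).edges).map w).sum ≤ ((m + 1 : ℕ) : NNReal) * w a := by
              refine hle.trans ?_
              rw [nsmul_eq_mul]
              gcongr
              simp only [List.length_map, Walk.length_edges, Walk.length_append]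
              omega
            exact_mod_cast hle'
          intro u' v' huv'
          rcases Sym2.eq_iff.1 (huv'.trans huv.symm) with ⟨rfl, rfl⟩ | ⟨rfl, rfl⟩
          · rw [wdist_comm]
            exact hsum
          · exact hsum
        · simpa using hcyc x (c.transfer _ (key c hac)) (hc.transfer _)

/-- Short paths with the same endpoints coincide when all cycles are long. -/
theorem SimpleGraph.Walk.IsPath.eq_of_length_add_le {V : Type*} {G : SimpleGraph V} {g : ℕ}
    (hcyc : ∀ x (c : G.Walk x x), c.IsCycle → g < c.length) {u v : V} {p q : G.Walk u v}
    (hp : p.IsPath) (hq : q.IsPath) (hlen : p.length + q.length ≤ g) : p = q := by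
  set K : SimpleGraph V := fromEdgeSet {e | e ∈ p.edges ++ q.edges} with hK
  have hKe : ∀ e ∈ p.edges ++ q.edges, e ∈ K.edgeSet := by
    intro e he
    have heG : e ∈ G.edgeSet := by
      rcases List.mem_append.1 he with h | h
      · exact p.edges_subset_edgeSet h
      · exact q.edges_subset_edgeSet h
    rw [hK, edgeSet_fromEdgeSet]
    exact ⟨he, G.not_isDiag_of_mem_edgeSet heG⟩
  have hKG : ∀ e ∈ K.edgeSet, e ∈ p.edges ++ q.edges := by
    intro e he
    rw [hK, edgeSet_fromEdgeSet] at he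
    exact he.1
  have hacyc : K.IsAcyclic := by
    intro x c hc
    have hsub : c.edges ⊆ p.edges ++ q.edges := fun e he => hKG e (c.edges_subset_edgeSet he)
    have hle := (hc.isCircuit.isTrail.edges_nodup.subperm hsub).length_le
    have hG : ∀ e ∈ c.edges, e ∈ G.edgeSet := by
      intro e he
      rcases List.mem_append.1 (hsub he) with h | h
      · exact p.edges_subset_edgeSet h
      · exact q.edges_subset_edgeSet h
    have hlt := hcyc x (c.transfer G hG) (hc.transfer hG)
    simp only [List.length_append, Walk.length_edges, Walk.length_transfer] at hle hlt
    omega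
  have hpK : ∀ e ∈ p.edges, e ∈ K.edgeSet := fun e he => hKe e (List.mem_append_left _ he)
  have hqK : ∀ e ∈ q.edges, e ∈ K.edgeSet := fun e he => hKe e (List.mem_append_right _ he)
  have := hacyc.subsingleton_path u v
  have heq := congrArg Subtype.val (Subsingleton.elim (⟨_, hp.transfer hpK⟩ : K.Path u v)
    ⟨_, hq.transfer hqK⟩)
  apply Walk.ext_support
  simpa using congrArg Walk.support heq

open Classical in
/-- In a graph without short cycles and with large minimum degree inside `S`, the number
of endpoints of paths of length `j` grows exponentially in `j`. -/
theorem exists_pow_le_card_endpoints {V : Type*} {G : SimpleGraph V} {k d : ℕ}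
    (hcyc : ∀ x (c : G.Walk x x), c.IsCycle → 2 * k < c.length) {S : Finset V} {v : V}
    (hv : v ∈ S) (hdeg : ∀ x ∈ S, d < (S.filter (G.Adj x)).card) {j : ℕ} (hj : j ≤ k) :
    ∃ A ⊆ S, (∀ x ∈ A, ∃ p : G.Walk v x, p.IsPath ∧ p.length = j) ∧ d ^ j ≤ A.card := by
  induction j with
  | zero =>
    refine ⟨{v}, by simpa using hv, fun x hx => ?_, by simp⟩
    obtain rfl := Finset.mem_singleton.1 hx
    exact ⟨.nil, by simp, rfl⟩
  | succ j ih =>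
    obtain ⟨A, hAS, hA, hcard⟩ := ih (by omega)
    have hpen : ∀ x, ∃ c, x ∈ A → ∃ p : G.Walk v x, p.IsPath ∧ p.length = j ∧
        p.penultimate = c := by
      intro x
      by_cases hx : x ∈ A
      · obtain ⟨p, hp, hpl⟩ := hA x hx
        exact ⟨p.penultimate, fun _ => ⟨p, hp, hpl, rfl⟩⟩
      · exact ⟨x, fun h => absurd h hx⟩
    choose c hc using hpen
    set N : V → Finset V := fun x => (S.filter (G.Adj x)).erase (c x) with hN
    have hmem : ∀ {x z}, z ∈ N x → z ≠ c x ∧ z ∈ S ∧ G.Adj x z := by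
      intro x z hz
      simpa [hN] using hz
    have hpath : ∀ {x z}, x ∈ A → z ∈ N x → ∃ q : G.Walk v z, q.IsPath ∧ q.length = j + 1 ∧
        q.penultimate = x := by
      intro x z hx hz
      obtain ⟨hzc, -, hxz⟩ := hmem hz
      obtain ⟨p, hp, hpl, hpc⟩ := hc x hx
      refine ⟨p.concat hxz, hp.concat (fun hs => hzc ?_) _, by rw [Walk.length_concat, hpl],
        Walk.penultimate_concat _ _⟩
      have hq : ((p.takeUntil z hs).concat hxz.symm).IsPath :=
        (hp.takeUntil hs).concat (Walk.endpoint_notMem_support_takeUntil hp hs hxz.ne) _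
      have hlt := p.length_takeUntil_lt_length hs hxz.ne'
      have heq := hq.eq_of_length_add_le hcyc hp (by
        rw [Walk.length_concat]
        omega)
      rw [← hpc, ← heq, Walk.penultimate_concat]
    refine ⟨A.biUnion N, ?_, ?_, ?_⟩
    · exact Finset.biUnion_subset.2 fun x _ z hz => (hmem hz).2.1
    · intro z hz
      obtain ⟨x, hx, hz⟩ := Finset.mem_biUnion.1 hz
      obtain ⟨q, hq, hql, -⟩ := hpath hx hz
      exact ⟨q, hq, hql⟩
    · rw [Finset.card_biUnion]
      · rw [pow_succ]
        calc d ^ j * d ≤ A.card * d := by gcongr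
          _ = ∑ _x ∈ A, d := by simp
          _ ≤ ∑ x ∈ A, (N x).card := by
            refine Finset.sum_le_sum fun x hx => ?_
            have h1 := hdeg x (hAS hx)
            have h2 := Finset.pred_card_le_card_erase (s := S.filter (G.Adj x))
              (a := c x)
            simp only [hN]
            omega
      · intro x hx y hy hxy
        refine Finset.disjoint_left.2 fun z hzx hzy => hxy ?_
        obtain ⟨p, hp, hpl, rfl⟩ := hpath hx hzx
        obtain ⟨q, hq, hql, rfl⟩ := hpath hy hzy
        rw [hp.eq_of_length_add_le hcyc hq (by omega)]

open Classical in
/-- A `d`-degenerate graph has at most `d` times as many edges as vertices. -/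
theorem card_filter_edges_le_of_degenerate {V : Type*} [Fintype V] {G : SimpleGraph V} {d : ℕ}
    (h : ∀ S : Finset V, S.Nonempty → ∃ x ∈ S, (S.filter (G.Adj x)).card ≤ d) (S : Finset V) :
    (G.edgeFinset.filter fun e => ∀ x ∈ e, x ∈ S).card ≤ d * S.card := by
  induction S using Finset.strongInduction with
  | H S ih =>
    rcases S.eq_empty_or_nonempty with rfl | hS
    · simp only [Finset.card_empty, mul_zero, Nat.le_zero, Finset.card_eq_zero]
      refine Finset.filter_eq_empty_iff.2 fun e _ he => ?_
      induction e with
      | h a b => simpa using he a (by simp)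
    · obtain ⟨v, hv, hd⟩ := h S hS
      have hsub : (G.edgeFinset.filter fun e => ∀ x ∈ e, x ∈ S) ⊆
          (G.edgeFinset.filter fun e => ∀ x ∈ e, x ∈ S.erase v) ∪
            (S.filter (G.Adj v)).image fun y => s(v, y) := by
        intro e he
        obtain ⟨heG, heS⟩ := Finset.mem_filter.1 he
        by_cases hve : v ∈ e
        · obtain ⟨y, rfl⟩ := Sym2.mem_iff_exists.1 hve
          refine Finset.mem_union_right _ (Finset.mem_image.2 ⟨y, ?_, rfl⟩)
          exact Finset.mem_filter.2 ⟨heS y (by simp), by simpa using heG⟩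
        · refine Finset.mem_union_left _ (Finset.mem_filter.2 ⟨heG, fun x hx => ?_⟩)
          exact Finset.mem_erase.2 ⟨fun hxv => hve (hxv ▸ hx), heS x hx⟩
      have h1 := ih _ (Finset.erase_ssubset hv)
      have h2 := (Finset.card_le_card hsub).trans (Finset.card_union_le _ _)
      have h3 := (Finset.card_image_le (s := S.filter (G.Adj v)) (f := fun y => s(v, y))).trans hd
      have h4 := Finset.card_erase_add_one hv
      rw [← h4, mul_add, mul_one]
      omega

/-- A weak form of the Moore bound: a graph without cycles of length at most `2 * k` is sparse. -/
theorem ncard_edgeSet_le_of_forall_isCycle {V : Type*} [Fintype V] {G : SimpleGraph V} {k d : ℕ}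
    (hcyc : ∀ x (c : G.Walk x x), c.IsCycle → 2 * k < c.length) (hd : Fintype.card V < d ^ k) :
    G.edgeSet.ncard ≤ d * Fintype.card V := by
  classical
  have h := card_filter_edges_le_of_degenerate (G := G) (d := d) (fun S hS => by
    by_contra! hdeg
    obtain ⟨v, hv⟩ := hS
    obtain ⟨A, -, -, hA⟩ := exists_pow_le_card_endpoints hcyc hv hdeg le_rfl
    exact absurd (hA.trans A.card_le_univ) (not_le.2 hd)) Finset.univ
  rw [← coe_edgeFinset, Set.ncard_coe_finset]
  simpa using h

/-- there is an absolute constant `C` such that every connected weighted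
graph on `n` vertices with positive edge weights has a `(2k-1)`-spanner with at most
`C·k·n^(1+1/k)` edges. -/
theorem exists_weighted_spanner_two_k_sub_one :
    ∃ C : ℝ, 0 < C ∧
      ∀ (k : ℕ), 1 ≤ k →
        ∀ (n : ℕ) (G : SimpleGraph (Fin n)) (w : Sym2 (Fin n) → NNReal),
          G.Connected → (∀ e ∈ G.edgeSet, 0 < w e) →
          ∃ H : SimpleGraph (Fin n),
            IsSpanner G H w (2 * (k : ℝ) - 1) ∧
            (H.edgeSet.ncard : ℝ) ≤ C * k * (n : ℝ) ^ ((1 : ℝ) + 1 / (k : ℝ)) := by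
  refine ⟨2, two_pos, fun k hk n G w hconn _ => ?_⟩
  classical
  obtain ⟨F, hFG, hdist, hcyc⟩ := exists_greedy_spanner w (2 * k - 2) G.edgeFinset
  rw [show 2 * k - 2 + 2 = 2 * k by omega] at hcyc
  have hkR : (1 : ℝ) ≤ k := by exact_mod_cast hk
  have hα : ENNReal.ofReal (2 * (k : ℝ) - 1) = ((2 * k - 2 + 1 : ℕ) : ENNReal) := by
    rw [← ENNReal.ofReal_natCast]
    congr 1
    rw [show 2 * k - 2 + 1 = 2 * k - 1 by omega, Nat.cast_sub (by omega)]
    push_cast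
    ring
  refine ⟨fromEdgeSet (F : Set (Sym2 (Fin n))), IsSpanner.of_adj ?_ (by linarith) ?_, ?_⟩
  · intro u v huv
    have := hFG (Finset.mem_coe.1 ((fromEdgeSet_adj _).1 huv).1)
    simpa using this
  · intro u v huv
    rw [hα]
    exact hdist u v (by simpa using huv)
  · have hn : (1 : ℝ) ≤ n := by
      have := hconn.nonempty
      exact_mod_cast Fin.pos_iff_nonempty.2 this
    have ht : (1 : ℝ) ≤ (n : ℝ) ^ ((1 : ℝ) / k) := Real.one_le_rpow hn (by positivity)
    set t : ℝ := (n : ℝ) ^ ((1 : ℝ) / k) with ht_def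
    have htk : t ^ k = n := by
      rw [ht_def, one_div, Real.rpow_inv_natCast_pow (by positivity) (by omega)]
    have hcard : Fintype.card (Fin n) < (⌊t⌋₊ + 1) ^ k := by
      rw [Fintype.card_fin]
      have : (n : ℝ) < ((⌊t⌋₊ : ℝ) + 1) ^ k := by
        rw [← htk]
        exact pow_lt_pow_left₀ (Nat.lt_floor_add_one t) (by linarith) (by omega)
      exact_mod_cast this
    have hle := ncard_edgeSet_le_of_forall_isCycle hcyc hcard
    rw [Fintype.card_fin] at hle
    have hfloor : (⌊t⌋₊ : ℝ) ≤ t := Nat.floor_le (by linarith)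
    have hpow : (n : ℝ) ^ ((1 : ℝ) + 1 / k) = n * t := by
      rw [Real.rpow_add (by linarith), Real.rpow_one]
    rw [hpow]
    calc ((fromEdgeSet (F : Set (Sym2 (Fin n)))).edgeSet.ncard : ℝ)
        ≤ ((⌊t⌋₊ : ℝ) + 1) * n := by exact_mod_cast hle
      _ ≤ (2 * t) * n := by gcongr; linarith
      _ = 2 * 1 * (n * t) := by ring
      _ ≤ 2 * k * (n * t) := by gcongr
end

section
/- There exists an absolute constant C such that for every integer k ≥ 2 and every connected unweighted graph G on n vertices, there exists a (2k−1)-spanner H of G with at most C·(n·k + n^{1+1/k}·log k) edges. -/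
open SimpleGraph

namespace SimpleGraph

variable {V : Type*}

/-- No edge of `G` can be bypassed by a walk of length less than `m` avoiding that edge.
Equivalently, every cycle of `G` has length greater than `m`. -/
def NoShortDetour (G : SimpleGraph V) (m : ℕ) : Prop :=
  ∀ ⦃u v : V⦄, G.Adj u v → ∀ p : (G.deleteEdges {s(u, v)}).Walk u v, m ≤ p.length

lemma NoShortDetour.mono {G H : SimpleGraph V} {m : ℕ} (hHG : H ≤ G) (hG : G.NoShortDetour m) :
    H.NoShortDetour m := fun u v huv p => by
  simpa using hG (hHG huv) (p.mapLe (deleteEdges_mono hHG))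

lemma noShortDetour_bot (m : ℕ) : (⊥ : SimpleGraph V).NoShortDetour m :=
  fun _ _ h => h.elim

/-- A walk using at most one new edge `s(u, v)` either shortcuts to a walk in the old graph,
or to two old walks joined by the new edge. -/
lemma exists_walk_or_split_of_walk_sup_edge {K : SimpleGraph V} {u v : V} {x y : V}
    (p : (K ⊔ edge u v).Walk x y) :
    (∃ q : K.Walk x y, q.length ≤ p.length) ∨
    (∃ (q₁ : K.Walk x u) (q₂ : K.Walk v y), q₁.length + q₂.length + 1 ≤ p.length) ∨
    (∃ (q₁ : K.Walk x v) (q₂ : K.Walk u y), q₁.length + q₂.length + 1 ≤ p.length) := by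
  induction p with
  | nil => exact .inl ⟨.nil, by simp⟩
  | @cons x z y h p ih =>
    rcases h with h | h
    · rcases ih with ⟨q, hq⟩ | ⟨q₁, q₂, hq⟩ | ⟨q₁, q₂, hq⟩
      · exact .inl ⟨.cons h q, by simpa using hq⟩
      · exact .inr (.inl ⟨.cons h q₁, q₂, by simp only [Walk.length_cons]; omega⟩)
      · exact .inr (.inr ⟨.cons h q₁, q₂, by simp only [Walk.length_cons]; omega⟩)
    · rw [edge_adj] at h
      rcases h with ⟨⟨rfl, rfl⟩ | ⟨rfl, rfl⟩, -⟩
      · rcases ih with ⟨q, hq⟩ | ⟨q₁, q₂, hq⟩ | ⟨q₁, q₂, hq⟩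
        · exact .inr (.inl ⟨.nil, q, by simpa using hq⟩)
        · exact .inr (.inl ⟨.nil, q₂, by simp only [Walk.length_cons, Walk.length_nil]; omega⟩)
        · exact .inl ⟨q₂, by simp only [Walk.length_cons]; omega⟩
      · rcases ih with ⟨q, hq⟩ | ⟨q₁, q₂, hq⟩ | ⟨q₁, q₂, hq⟩
        · exact .inr (.inr ⟨.nil, q, by simpa using hq⟩)
        · exact .inl ⟨q₂, by simp only [Walk.length_cons]; omega⟩
        · exact .inr (.inr ⟨.nil, q₂, by simp only [Walk.length_cons, Walk.length_nil]; omega⟩)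

lemma NoShortDetour.sup_edge {H : SimpleGraph V} {m : ℕ} (hH : H.NoShortDetour m) {u v : V}
    (huv : ∀ p : H.Walk u v, m ≤ p.length) : (H ⊔ edge u v).NoShortDetour m := by
  intro x y hxy p
  have hle : (H ⊔ edge u v).deleteEdges {s(x, y)} ≤ H.deleteEdges {s(x, y)} ⊔ edge u v := by
    intro a b hab
    simp only [deleteEdges_adj, sup_adj] at hab ⊢
    tauto
  by_cases hxyH : H.Adj x y
  · rcases exists_walk_or_split_of_walk_sup_edge (p.mapLe hle) with
      ⟨q, hq⟩ | ⟨q₁, q₂, hq⟩ | ⟨q₁, q₂, hq⟩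
    · have := hH hxyH q
      simp only [Walk.length_mapLe] at hq
      omega
    · have := huv (((q₁.mapLe (deleteEdges_le _)).reverse.append (.cons hxyH .nil)).append
        (q₂.mapLe (deleteEdges_le _)).reverse)
      simp at this hq
      omega
    · have := huv (((q₂.mapLe (deleteEdges_le _)).append (.cons hxyH.symm .nil)).append
        (q₁.mapLe (deleteEdges_le _)))
      simp at this hq
      omega
  · have he : (edge u v).Adj x y := (sup_adj .. |>.1 hxy).resolve_left hxyH
    rw [edge_adj] at he
    have hle' : (H ⊔ edge u v).deleteEdges {s(x, y)} ≤ H := by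
      intro a b hab
      simp only [deleteEdges_adj, sup_adj, edge_adj, Set.mem_singleton_iff, Sym2.eq_iff] at hab
      rcases he with ⟨⟨rfl, rfl⟩ | ⟨rfl, rfl⟩, -⟩ <;> tauto
    rcases he with ⟨⟨rfl, rfl⟩ | ⟨rfl, rfl⟩, -⟩
    · simpa using huv (p.mapLe hle')
    · simpa using huv (p.mapLe hle').reverse

/-- Every finite graph has a subgraph without short detours in which all edges have short
replacements. -/
lemma exists_le_noShortDetour_forall_adj [Finite V] (G : SimpleGraph V) {m : ℕ} (hm : 2 ≤ m) :
    ∃ H ≤ G, H.NoShortDetour m ∧ ∀ u v, G.Adj u v → ∃ p : H.Walk u v, p.length < m := by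
  obtain ⟨H, hH⟩ := (Set.toFinite {H : SimpleGraph V | H ≤ G ∧ H.NoShortDetour m}).exists_maximal
    ⟨⊥, bot_le, noShortDetour_bot m⟩
  refine ⟨H, hH.prop.1, hH.prop.2, fun u v huv => ?_⟩
  by_contra! hp
  have hle := hH.le_of_ge (y := H ⊔ edge u v)
    ⟨sup_le hH.prop.1 ((edge_le_iff G).2 (.inr huv)), hH.prop.2.sup_edge hp⟩ le_sup_left
  have hadj : H.Adj u v := hle (.inr (by simp [edge_adj, huv.ne]))
  have := hp (.cons hadj .nil)
  simp at this
  omega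

lemma exists_walk_length_eq_dist_notMem_support {G : SimpleGraph V} {r a w : V}
    (ha : G.Reachable r a) (hne : w ≠ a) (hle : G.dist r a ≤ G.dist r w) :
    ∃ p : G.Walk r a, p.length = G.dist r a ∧ w ∉ p.support := by
  classical
  obtain ⟨p, hp⟩ := ha.exists_walk_length_eq_dist
  refine ⟨p, hp, fun hw => ?_⟩
  have h1 := dist_le (p.takeUntil w hw)
  have h2 := p.length_takeUntil_lt_length hw hne
  omega

lemma NoShortDetour.eq_of_adj_of_dist_le {G : SimpleGraph V} {m : ℕ} (hG : G.NoShortDetour m)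
    {r w a b : V} (hw : G.Reachable r w) (ha : G.Adj w a) (hb : G.Adj w b)
    (hda : G.dist r a ≤ G.dist r w) (hdb : G.dist r b ≤ G.dist r w)
    (hm : G.dist r a + G.dist r b + 1 < m) : a = b := by
  by_contra hab
  obtain ⟨p, hp, hwp⟩ :=
    exists_walk_length_eq_dist_notMem_support (hw.trans ha.reachable) ha.ne hda
  obtain ⟨q, hq, hwq⟩ :=
    exists_walk_length_eq_dist_notMem_support (hw.trans hb.reachable) hb.ne hdb
  let c : G.Walk a w := (p.reverse.append q).append (.cons hb.symm .nil)
  have hc : s(a, w) ∉ c.edges := by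
    simp only [c, Walk.edges_append, Walk.edges_reverse, Walk.edges_cons, Walk.edges_nil,
      List.mem_append, List.mem_reverse, List.mem_singleton, not_or]
    refine ⟨⟨fun h => hwp (p.snd_mem_support_of_mem_edges h),
      fun h => hwq (q.snd_mem_support_of_mem_edges h)⟩, ?_⟩
    simp [hab, ha.ne']
  have := hG ha.symm (c.toDeleteEdge _ hc)
  have hlen : c.length = p.length + q.length + 1 := by
    simp only [c, Walk.length_append, Walk.length_reverse, Walk.length_cons, Walk.length_nil]
  rw [Walk.toDeleteEdge, Walk.toDeleteEdges, Walk.length_transfer] at this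
  omega

/-- Moore bound: without cycles of length at most `2 * k`, the spheres around a vertex grow
geometrically. -/
lemma NoShortDetour.pow_le_card_sphere [Fintype V] {G : SimpleGraph V}
    [DecidableRel G.Adj] {k d : ℕ} (hG : G.NoShortDetour (2 * k))
    (hd : ∀ x y, G.Adj x y → d < G.degree x) {r s : V} (hr : G.Adj r s) {i : ℕ} (hi : i ≤ k) :
    d ^ i ≤ {x | G.Reachable r x ∧ G.dist r x = i}.ncard := by
  classical
  induction i with
  | zero =>
    rw [pow_zero, Nat.one_le_iff_ne_zero]
    exact Set.ncard_ne_zero_of_mem (a := r) ⟨.refl r, dist_self⟩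
  | succ i ih =>
    let N (j : ℕ) : Finset V := {x | G.Reachable r x ∧ G.dist r x = j}
    have hN (j : ℕ) : {x | G.Reachable r x ∧ G.dist r x = j}.ncard = (N j).card := by
      rw [← Set.ncard_coe_finset]
      simp [N]
    rw [hN] at ih ⊢
    have hmul : (N i).card * d ≤ (N (i + 1)).card * 1 := by
      refine Finset.card_mul_le_card_mul G.Adj (fun w hw => ?_) (fun y hy => ?_)
      · simp only [N, Finset.mem_filter_univ] at hw
        obtain ⟨z, hz⟩ : ∃ z, G.Adj w z := by
          by_cases hwr : w = r
          · exact ⟨s, hwr ▸ hr⟩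
          · obtain ⟨p⟩ := hw.1.symm
            cases p with
            | nil => exact absurd rfl hwr
            | cons h _ => exact ⟨_, h⟩
        have hdeg := hd w z hz
        have hone : ((G.neighborFinset w).filter (fun x => G.dist r x ≤ i)).card ≤ 1 := by
          rw [Finset.card_le_one]
          intro a ha b hb
          simp only [Finset.mem_filter, mem_neighborFinset] at ha hb
          exact hG.eq_of_adj_of_dist_le hw.1 ha.1 hb.1 (by omega) (by omega) (by omega)
        have hsub : (G.neighborFinset w).filter (fun x => ¬ G.dist r x ≤ i) ⊆
            Finset.bipartiteAbove G.Adj (N (i + 1)) w := by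
          intro x hx
          simp only [Finset.mem_filter, mem_neighborFinset] at hx
          have hrx := hw.1.trans hx.1.reachable
          obtain ⟨p, hp⟩ := hw.1.exists_walk_length_eq_dist
          have := dist_le (p.concat hx.1)
          rw [Walk.length_concat] at this
          simp only [Finset.mem_bipartiteAbove, N, Finset.mem_filter_univ]
          exact ⟨⟨hrx, by omega⟩, hx.1⟩
        have hsum := Finset.card_filter_add_card_filter_not (s := G.neighborFinset w)
          (fun x => G.dist r x ≤ i)
        rw [card_neighborFinset_eq_degree] at hsum
        have := Finset.card_le_card hsub
        omega
      · simp only [N, Finset.mem_filter_univ] at hy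
        rw [Finset.card_le_one]
        intro a ha b hb
        simp only [Finset.mem_bipartiteBelow, N, Finset.mem_filter_univ] at ha hb
        exact hG.eq_of_adj_of_dist_le hy.1 ha.2.symm hb.2.symm (by omega) (by omega) (by omega)
    rw [pow_succ]
    calc d ^ i * d ≤ (N i).card * d := Nat.mul_le_mul_right _ (ih (by omega))
      _ ≤ _ := by simpa using hmul

lemma NoShortDetour.pow_lt_card [Fintype V] {G : SimpleGraph V}
    [DecidableRel G.Adj] {k d : ℕ} (hk : k ≠ 0) (hG : G.NoShortDetour (2 * k))
    (hd : ∀ x y, G.Adj x y → d < G.degree x) {r s : V} (hr : G.Adj r s) :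
    d ^ k < Fintype.card V := by
  refine (hG.pow_le_card_sphere hd hr le_rfl).trans_lt ?_
  rw [← Nat.card_eq_fintype_card]
  refine Set.ncard_lt_card fun h => ?_
  have : r ∈ {x | G.Reachable r x ∧ G.dist r x = k} := h ▸ Set.mem_univ r
  exact hk (by simpa using this.2.symm)

lemma NoShortDetour.ncard_edgeSet_le [Fintype V] {k d : ℕ} (hk : k ≠ 0)
    (hd : Fintype.card V ≤ d ^ k) {G : SimpleGraph V} (hG : G.NoShortDetour (2 * k)) :
    G.edgeSet.ncard ≤ d * G.support.ncard := by
  classical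
  induction hs : G.support.ncard using Nat.strong_induction_on generalizing G with
  | _ s ih =>
    subst hs
    by_cases hlow : ∃ x y, G.Adj x y ∧ G.degree x ≤ d
    · obtain ⟨x, y, hxy, hx⟩ := hlow
      have hlt : (G.deleteIncidenceSet x).support.ncard < G.support.ncard := by
        refine Set.ncard_lt_ncard ⟨support_mono (G.deleteIncidenceSet_le x), fun h => ?_⟩
        obtain ⟨z, hz⟩ := h ⟨y, hxy⟩
        simp [deleteIncidenceSet_adj] at hz
      have h1 := ih _ hlt (hG.mono (G.deleteIncidenceSet_le x)) rfl
      have h2 := G.card_edgeFinset_deleteIncidenceSet x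
      rw [← coe_edgeFinset, Set.ncard_coe_finset] at h1 ⊢
      have h3 : d * ((G.deleteIncidenceSet x).support.ncard + 1) ≤ d * G.support.ncard :=
        Nat.mul_le_mul_left _ hlt
      rw [mul_add] at h3
      omega
    · push Not at hlow
      rcases G.edgeSet.eq_empty_or_nonempty with he | ⟨e, he⟩
      · simp [he]
      · induction e with
        | _ r s => exact absurd (hG.pow_lt_card hk hlow he) hd.not_gt

lemma exists_walk_length_le_mul {G H : SimpleGraph V} {m : ℕ}
    (h : ∀ u v, G.Adj u v → ∃ p : H.Walk u v, p.length ≤ m) {u v : V} (p : G.Walk u v) :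
    ∃ q : H.Walk u v, q.length ≤ m * p.length := by
  induction p with
  | nil => exact ⟨.nil, by simp⟩
  | cons hadj p ih =>
    obtain ⟨q, hq⟩ := ih
    obtain ⟨q', hq'⟩ := h _ _ hadj
    exact ⟨q'.append q, by rw [Walk.length_append, Walk.length_cons, mul_add]; omega⟩

end SimpleGraph

lemma isSpanner_one_of_forall_adj {V : Type*} {G H : SimpleGraph V} {m : ℕ} (hm : m ≠ 0)
    (hHG : H ≤ G) (h : ∀ u v, G.Adj u v → ∃ p : H.Walk u v, p.length ≤ m) :
    IsSpanner G H (fun _ => 1) m := by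
  refine ⟨hHG, fun u v => ?_⟩
  rw [ENNReal.ofReal_natCast, wdist, wdist,
    ENNReal.mul_iInf_of_ne (by simpa using hm) (ENNReal.natCast_ne_top m)]
  refine le_iInf fun p => ?_
  obtain ⟨q, hq⟩ := exists_walk_length_le_mul h p
  refine (iInf_le _ q).trans ?_
  simp only [List.map_const', List.sum_replicate, Walk.length_edges, nsmul_eq_mul, mul_one]
  exact_mod_cast hq

/-- there is an absolute constant `C` such that every connected unweighted
graph on `n` vertices has a `(2k-1)`-spanner with at most `C·(n·k + n^(1+1/k)·log k)` edges. -/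
theorem exists_unweighted_spanner_two_k_sub_one :
    ∃ C : ℝ, 0 < C ∧
      ∀ (k : ℕ), 2 ≤ k →
        ∀ (n : ℕ) (G : SimpleGraph (Fin n)), G.Connected →
          ∃ H : SimpleGraph (Fin n),
            IsSpanner G H (fun _ => 1) (2 * (k : ℝ) - 1) ∧
            (H.edgeSet.ncard : ℝ) ≤
              C * ((n : ℝ) * k + (n : ℝ) ^ ((1 : ℝ) + 1 / (k : ℝ)) * Real.logb 2 k) := by
  refine ⟨2, two_pos, fun k hk n G hG => ?_⟩
  obtain ⟨H, hHG, hH, hwalk⟩ := G.exists_le_noShortDetour_forall_adj (m := 2 * k) (by omega)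
  refine ⟨H, ?_, ?_⟩
  · have := isSpanner_one_of_forall_adj (m := 2 * k - 1) (by omega) hHG fun u v huv => by
      obtain ⟨p, hp⟩ := hwalk u v huv
      exact ⟨p, by omega⟩
    rwa [Nat.cast_sub (by omega), Nat.cast_mul, Nat.cast_ofNat, Nat.cast_one] at this
  · have hn : 1 ≤ n := Fin.pos_iff_nonempty.2 hG.nonempty
    have hn' : (1 : ℝ) ≤ n := by exact_mod_cast hn
    set t : ℝ := (n : ℝ) ^ (1 / (k : ℝ)) with ht
    have ht1 : 1 ≤ t := Real.one_le_rpow hn' (by positivity)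
    have htk : t ^ k = n := by
      rw [ht, one_div, Real.rpow_inv_natCast_pow (by positivity) (by omega)]
    have hd : Fintype.card (Fin n) ≤ ⌈t⌉₊ ^ k := by
      rw [Fintype.card_fin]
      have : t ^ k ≤ (⌈t⌉₊ : ℝ) ^ k := pow_le_pow_left₀ (by positivity) (Nat.le_ceil t) k
      rw [htk] at this
      exact_mod_cast this
    have hE : H.edgeSet.ncard ≤ ⌈t⌉₊ * n :=
      (hH.ncard_edgeSet_le (by omega) hd).trans
        (Nat.mul_le_mul_left _ (by simpa using Set.ncard_le_card H.support))
    have hE' : (H.edgeSet.ncard : ℝ) ≤ ⌈t⌉₊ * n := by exact_mod_cast hE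
    have hceil : (⌈t⌉₊ : ℝ) ≤ 2 * t := by
      linarith [Nat.ceil_lt_add_one (zero_le_one.trans ht1)]
    have hlog : 1 ≤ Real.logb 2 k := by
      rw [Real.le_logb_iff_rpow_le one_lt_two (by positivity), Real.rpow_one]
      exact_mod_cast hk
    rw [Real.rpow_add (by positivity), Real.rpow_one, ← ht]
    calc (H.edgeSet.ncard : ℝ) ≤ ⌈t⌉₊ * n := hE'
      _ ≤ 2 * t * n := by gcongr
      _ = 2 * (n * t * 1) := by ring
      _ ≤ 2 * (n * t * Real.logb 2 k) := by gcongr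
      _ ≤ 2 * (n * k + n * t * Real.logb 2 k) := by
        gcongr
        exact le_add_of_nonneg_left (by positivity)
end

section
/- There exists an absolute constant C such that every connected unweighted graph G on n ≥ 2 vertices has a spanner H with at most C·n edges and stretch at most C·(log n)·2^{log* n}, i.e., H is a (C·(log n)·2^{log* n})-spanner of G. -/
open SimpleGraph

/-- The iterated (base-2) logarithm: the number of times `logb 2` must be applied to `x`
before the result becomes at most `1`. -/
noncomputable def logStar (x : ℝ) : ℕ :=
  sInf {k : ℕ | (Real.logb 2)^[k] x ≤ 1}

/-- One ball-growing step inside `S`: add to `B` its `G`-neighbours lying in `S`. -/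
noncomputable def ballStep {V : Type*} [DecidableEq V] (G : SimpleGraph V) (S B : Finset V) :
    Finset V := by
  classical
  exact B ∪ S.filter (fun u => ∃ w ∈ B, G.Adj w u)

theorem subset_ballStep {V : Type*} [DecidableEq V] (G : SimpleGraph V) (S B : Finset V) :
    B ⊆ ballStep G S B := by
  classical
  exact Finset.subset_union_left

theorem mem_ballStep {V : Type*} [DecidableEq V] {G : SimpleGraph V} {S B : Finset V} {u : V} :
    u ∈ ballStep G S B ↔ u ∈ B ∨ (u ∈ S ∧ ∃ w ∈ B, G.Adj w u) := by
  classical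
  simp [ballStep]

theorem iterate_ballStep_subset {V : Type*} [DecidableEq V] (G : SimpleGraph V) {S : Finset V}
    {v : V} (hv : v ∈ S) (i : ℕ) : (ballStep G S)^[i] {v} ⊆ S := by
  induction i with
  | zero => simpa using hv
  | succ i ih =>
    intro u hu
    rw [Function.iterate_succ_apply', mem_ballStep] at hu
    exact hu.elim (fun h => ih h) (fun h => h.1)

/-- A ball of radius `i` is spanned by fewer edges than it has vertices, along walks of length at
most `i` from the centre. -/
theorem exists_tree_iterate_ballStep {V : Type*} [DecidableEq V] (G : SimpleGraph V)
    (S : Finset V) (v : V) (i : ℕ) :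
    ∃ E : Finset (Sym2 V), (E : Set (Sym2 V)) ⊆ G.edgeSet ∧
      E.card ≤ ((ballStep G S)^[i] {v}).card ∧
      ∀ u ∈ (ballStep G S)^[i] {v}, ∃ p : (fromEdgeSet (E : Set (Sym2 V))).Walk v u,
        p.length ≤ i := by
  induction i with
  | zero =>
    refine ⟨∅, by simp, by simp, ?_⟩
    intro u hu
    obtain rfl : u = v := by simpa using hu
    exact ⟨.nil, le_rfl⟩
  | succ i ih =>
    obtain ⟨E, hEG, hcard, hE⟩ := ih
    rw [Function.iterate_succ_apply']
    set B := (ballStep G S)^[i] {v}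
    have hparent : ∀ u, ∃ w, u ∈ ballStep G S B \ B → w ∈ B ∧ G.Adj w u := by
      intro u
      by_cases hu : u ∈ ballStep G S B \ B
      · rw [Finset.mem_sdiff, mem_ballStep] at hu
        obtain ⟨w, hw⟩ := (hu.1.resolve_left hu.2).2
        exact ⟨w, fun _ => hw⟩
      · exact ⟨u, fun h => absurd h hu⟩
    choose f hf using hparent
    refine ⟨E ∪ (ballStep G S B \ B).image (fun u => s(f u, u)), ?_, ?_, ?_⟩
    · intro e he
      simp only [Finset.coe_union, Set.mem_union, Finset.mem_coe, Finset.mem_image] at he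
      rcases he with he | ⟨u, hu, rfl⟩
      · exact hEG he
      · exact (hf u hu).2
    · have h₁ := Finset.card_union_le E ((ballStep G S B \ B).image (fun u => s(f u, u)))
      have h₂ := Finset.card_image_le (s := ballStep G S B \ B) (f := fun u => s(f u, u))
      have h₃ := Finset.card_sdiff_add_card_eq_card (subset_ballStep G S B)
      omega
    · have hmono : fromEdgeSet (E : Set (Sym2 V)) ≤ fromEdgeSet
          ((E ∪ (ballStep G S B \ B).image (fun u => s(f u, u)) : Finset (Sym2 V)) :
            Set (Sym2 V)) :=
        fromEdgeSet_mono (by simp)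
      intro u hu
      by_cases huB : u ∈ B
      · obtain ⟨p, hp⟩ := hE u huB
        exact ⟨p.mapLe hmono, by simpa using hp.trans (Nat.le_succ i)⟩
      · have hmem : u ∈ ballStep G S B \ B := Finset.mem_sdiff.2 ⟨hu, huB⟩
        obtain ⟨hw, hadj⟩ := hf u hmem
        obtain ⟨p, hp⟩ := hE _ hw
        have hadj' : (fromEdgeSet ((E ∪ (ballStep G S B \ B).image (fun u => s(f u, u)) :
            Finset (Sym2 V)) : Set (Sym2 V))).Adj (f u) u := by
          rw [fromEdgeSet_adj]
          exact ⟨Finset.mem_coe.2 (Finset.mem_union_right _ (Finset.mem_image_of_mem _ hmem)),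
            hadj.ne⟩
        exact ⟨(p.mapLe hmono).concat hadj', by simpa [Walk.length_concat] using hp⟩

/-- Some ball of at most logarithmic radius at most doubles in the next step. -/
theorem exists_card_ballStep_le {V : Type*} [DecidableEq V] (G : SimpleGraph V) {S : Finset V}
    {v : V} (hv : v ∈ S) {L : ℕ} (hL : S.card < 2 ^ (L + 1)) :
    ∃ r ≤ L, ((ballStep G S)^[r + 1] {v}).card ≤ 2 * ((ballStep G S)^[r] {v}).card := by
  by_contra! h
  have hgrow : ∀ i ≤ L + 1, 2 ^ i ≤ ((ballStep G S)^[i] {v}).card := by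
    intro i
    induction i with
    | zero => simp
    | succ i ih =>
      intro hi
      have h₁ := ih (by omega)
      have h₂ := h i (by omega)
      rw [pow_succ]
      omega
  have h₁ := hgrow (L + 1) le_rfl
  have h₂ := Finset.card_le_card (iterate_ballStep_subset G hv (L + 1))
  omega

/-- The edges inside `S` are stretched by at most `2 * (L + 1)` by a set of at most `2 * #S`
edges, as soon as `#S < 2 ^ (L + 1)`. -/
theorem exists_sparse_edges_stretch {V : Type*} [DecidableEq V] (G : SimpleGraph V) (L : ℕ)
    (S : Finset V) (hL : S.card < 2 ^ (L + 1)) :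
    ∃ E : Finset (Sym2 V), (E : Set (Sym2 V)) ⊆ G.edgeSet ∧ E.card ≤ 2 * S.card ∧
      ∀ x ∈ S, ∀ y ∈ S, G.Adj x y →
        ∃ p : (fromEdgeSet (E : Set (Sym2 V))).Walk x y, p.length ≤ 2 * (L + 1) := by
  induction S using Finset.strongInduction with
  | H S ih =>
    rcases S.eq_empty_or_nonempty with rfl | ⟨v, hv⟩
    · exact ⟨∅, by simp, by simp, by simp⟩
    obtain ⟨r, hr, hdouble⟩ := exists_card_ballStep_le G hv hL
    obtain ⟨T, hTG, hTcard, hT⟩ := exists_tree_iterate_ballStep G S v (r + 1)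
    have hBS := iterate_ballStep_subset G hv r
    have hstep : (ballStep G S)^[r + 1] {v} = ballStep G S ((ballStep G S)^[r] {v}) :=
      Function.iterate_succ_apply' _ _ _
    have hvB : v ∈ (ballStep G S)^[r] {v} := by
      clear * -
      induction r with
      | zero => simp
      | succ r ih =>
        rw [Function.iterate_succ_apply']
        exact subset_ballStep _ _ _ ih
    set B := (ballStep G S)^[r] {v}
    have hss : S \ B ⊂ S := Finset.sdiff_ssubset hBS ⟨v, hvB⟩
    obtain ⟨E, hEG, hEcard, hE⟩ :=
      ih (S \ B) hss ((Finset.card_le_card hss.subset).trans_lt hL)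
    have hET : fromEdgeSet (E : Set (Sym2 V)) ≤
        fromEdgeSet ((T ∪ E : Finset (Sym2 V)) : Set (Sym2 V)) := fromEdgeSet_mono (by simp)
    have hTT : fromEdgeSet (T : Set (Sym2 V)) ≤
        fromEdgeSet ((T ∪ E : Finset (Sym2 V)) : Set (Sym2 V)) := fromEdgeSet_mono (by simp)
    have hin : ∀ x ∈ S, ∀ y ∈ S, x ∈ B → G.Adj x y →
        ∃ p : (fromEdgeSet ((T ∪ E : Finset (Sym2 V)) : Set (Sym2 V))).Walk x y,
          p.length ≤ 2 * (L + 1) := by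
      intro x _ y hy hxB hxy
      obtain ⟨p, hp⟩ := hT x (hstep ▸ subset_ballStep _ _ _ hxB)
      obtain ⟨q, hq⟩ := hT y (hstep ▸ mem_ballStep.2 (.inr ⟨hy, x, hxB, hxy⟩))
      refine ⟨(p.reverse.append q).mapLe hTT, ?_⟩
      simp only [Walk.length_map, Walk.length_append, Walk.length_reverse]
      omega
    refine ⟨T ∪ E, ?_, ?_, ?_⟩
    · rw [Finset.coe_union]
      exact Set.union_subset hTG hEG
    · have h₁ := Finset.card_union_le T E
      have h₂ := Finset.card_sdiff_add_card_eq_card hBS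
      omega
    · intro x hx y hy hxy
      by_cases hxB : x ∈ B
      · exact hin x hx y hy hxB hxy
      by_cases hyB : y ∈ B
      · obtain ⟨p, hp⟩ := hin y hy x hx hyB hxy.symm
        exact ⟨p.reverse, by simpa using hp⟩
      · obtain ⟨p, hp⟩ := hE x (Finset.mem_sdiff.2 ⟨hx, hxB⟩) y
          (Finset.mem_sdiff.2 ⟨hy, hyB⟩) hxy
        exact ⟨p.mapLe hET, by simpa using hp⟩

/-- In an unweighted graph the stretch of a subgraph is controlled by the stretch of edges. -/
theorem isSpanner_one_of_adj {V : Type*} {G H : SimpleGraph V} (hHG : H ≤ G) {t : ℕ} {α : ℝ}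
    (hα : 0 < α) (ht : (t : ℝ) ≤ α)
    (hadj : ∀ x y, G.Adj x y → ∃ p : H.Walk x y, p.length ≤ t) :
    IsSpanner G H (fun _ => 1) α := by
  have hwalk : ∀ {u v : V} (p : G.Walk u v), ∃ q : H.Walk u v, q.length ≤ t * p.length := by
    intro u v p
    induction p with
    | nil => exact ⟨.nil, by simp⟩
    | cons h p ih =>
      obtain ⟨q, hq⟩ := ih
      obtain ⟨q', hq'⟩ := hadj _ _ h
      refine ⟨q'.append q, ?_⟩
      rw [Walk.length_append, Walk.length_cons, mul_add, mul_one]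
      omega
  refine ⟨hHG, fun u v => ?_⟩
  unfold wdist
  rw [ENNReal.mul_iInf_of_ne (by simpa using hα) ENNReal.ofReal_ne_top]
  refine le_iInf fun p => ?_
  obtain ⟨q, hq⟩ := hwalk p
  refine (iInf_le _ q).trans ?_
  have htα : (t : ENNReal) ≤ ENNReal.ofReal α := by
    rw [← ENNReal.ofReal_natCast]
    exact ENNReal.ofReal_le_ofReal ht
  simp only [List.map_const', List.sum_replicate, Walk.length_edges, nsmul_eq_mul, mul_one,
    ENNReal.coe_natCast]
  calc (q.length : ENNReal) ≤ ((t * p.length : ℕ) : ENNReal) := by exact_mod_cast hq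
    _ = (t : ENNReal) * p.length := by push_cast; rfl
    _ ≤ ENNReal.ofReal α * p.length := by gcongr

/-- every connected unweighted graph on `n ≥ 2` vertices has a spanner with
`O(n)` edges and stretch `O(log n · 2^(log* n))`. -/
theorem exists_linear_size_spanner_unweighted :
    ∃ C : ℝ, 0 < C ∧
      ∀ (n : ℕ), 2 ≤ n →
        ∀ (G : SimpleGraph (Fin n)), G.Connected →
          ∃ H : SimpleGraph (Fin n),
            IsSpanner G H (fun _ => 1) (C * Real.logb 2 n * (2 : ℝ) ^ logStar (n : ℝ)) ∧
            (H.edgeSet.ncard : ℝ) ≤ C * n := by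
  refine ⟨4, by norm_num, fun n hn G _ => ?_⟩
  obtain ⟨E, hEG, hEcard, hE⟩ := exists_sparse_edges_stretch G (Nat.log 2 n) Finset.univ
    (by simpa using Nat.lt_pow_succ_log_self one_lt_two n)
  have hn' : (2 : ℝ) ≤ n := by exact_mod_cast hn
  have hlog : (1 : ℝ) ≤ Real.logb 2 n := by
    rw [Real.le_logb_iff_rpow_le one_lt_two (by linarith)]
    simpa using hn'
  have hfloor : (Nat.log 2 n : ℝ) ≤ Real.logb 2 n := by
    exact_mod_cast Real.natLog_le_logb n 2
  have hpow : (1 : ℝ) ≤ 2 ^ logStar (n : ℝ) := one_le_pow₀ one_le_two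
  have hmul : 4 * Real.logb 2 n ≤ 4 * Real.logb 2 n * 2 ^ logStar (n : ℝ) :=
    le_mul_of_one_le_right (by linarith) hpow
  refine ⟨fromEdgeSet (E : Set (Sym2 (Fin n))), isSpanner_one_of_adj ?_ (by linarith)
    (t := 2 * (Nat.log 2 n + 1)) ?_ fun x y => hE x (Finset.mem_univ x) y (Finset.mem_univ y), ?_⟩
  · exact (fromEdgeSet_mono hEG).trans (fromEdgeSet_edgeSet G).le
  · push_cast
    linarith
  · have hsub : (fromEdgeSet (E : Set (Sym2 (Fin n)))).edgeSet ⊆ (E : Set (Sym2 (Fin n))) := by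
      rw [edgeSet_fromEdgeSet]
      exact Set.sdiff_subset
    have h₁ := Set.ncard_le_ncard hsub E.finite_toSet
    rw [Set.ncard_coe_finset] at h₁
    have h₂ : (fromEdgeSet (E : Set (Sym2 (Fin n)))).edgeSet.ncard ≤ 2 * n := by
      simpa using h₁.trans hEcard
    have h₃ : ((fromEdgeSet (E : Set (Sym2 (Fin n)))).edgeSet.ncard : ℝ) ≤ 2 * n := by
      exact_mod_cast h₂
    linarith
end

section
/- There exists an absolute constant C such that for every real t ≥ 1, every connected unweighted graph G on n ≥ 2 vertices has a spanner H with at most n + n/t edges and stretch at most C·t·(log n)·2^{log* n}. -/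
open SimpleGraph

/-- Adjoining to `T` one edge from each vertex of `D` to a vertex within `r` steps of `v`
costs at most `#D` edges and puts `D` within `r + 1` steps of `v`. -/
lemma exists_extension_of_adj {V : Type*} [Finite V] {G T : SimpleGraph V} (hT : T ≤ G)
    {v : V} {r : ℕ} (D : Finset V)
    (hD : ∀ y ∈ D, ∃ x, G.Adj x y ∧ ∃ p : T.Walk v x, p.length ≤ r) :
    ∃ T' : SimpleGraph V, T ≤ T' ∧ T' ≤ G ∧ T'.edgeSet.ncard ≤ T.edgeSet.ncard + D.card ∧
      ∀ y ∈ D, ∃ p : T'.Walk v y, p.length ≤ r + 1 := by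
  classical
  choose! f hadj hwalk using hD
  refine ⟨T ⊔ fromEdgeSet (D.image fun y => s(f y, y)), le_sup_left, sup_le hT ?_, ?_, ?_⟩
  · intro a b hab
    rw [fromEdgeSet_adj] at hab
    obtain ⟨y, hy, hyab⟩ := Finset.mem_image.mp hab.1
    rw [← mem_edgeSet, ← hyab]
    exact hadj y hy
  · rw [edgeSet_sup, edgeSet_fromEdgeSet]
    refine (Set.ncard_union_le _ _).trans (Nat.add_le_add_left ?_ _)
    refine (Set.ncard_le_ncard Set.sdiff_subset (Finset.finite_toSet _)).trans ?_
    rw [Set.ncard_coe_finset]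
    exact Finset.card_image_le
  · intro y hy
    obtain ⟨p, hp⟩ := hwalk y hy
    have hfy : (T ⊔ fromEdgeSet (D.image fun y => s(f y, y) : Set (Sym2 V))).Adj (f y) y := by
      rw [sup_adj, fromEdgeSet_adj]
      exact Or.inr ⟨Finset.mem_image_of_mem _ hy, (hadj y hy).ne⟩
    refine ⟨(p.mapLe le_sup_left).concat hfy, ?_⟩
    rw [Walk.length_concat]
    simpa using hp

open Classical in
/-- The ball of radius `r` around `v` in the subgraph of `G` induced by `insert v S`. -/
noncomputable def ballIn {V : Type*} (G : SimpleGraph V) (S : Finset V) (v : V) : ℕ → Finset V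
  | 0 => {v}
  | r + 1 => ballIn G S v r ∪ S.filter fun y => ∃ x ∈ ballIn G S v r, G.Adj x y

section ballIn

variable {V : Type*} {G : SimpleGraph V} {S : Finset V} {v : V}

lemma ballIn_subset_succ (r : ℕ) : ballIn G S v r ⊆ ballIn G S v (r + 1) := by
  classical
  exact Finset.subset_union_left

lemma mem_ballIn_self (r : ℕ) : v ∈ ballIn G S v r := by
  induction r with
  | zero => exact Finset.mem_singleton_self v
  | succ r ih => exact ballIn_subset_succ r ih

lemma ballIn_subset (hv : v ∈ S) (r : ℕ) : ballIn G S v r ⊆ S := by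
  classical
  induction r with
  | zero => exact Finset.singleton_subset_iff.mpr hv
  | succ r ih => exact Finset.union_subset ih (Finset.filter_subset _ _)

lemma mem_ballIn_succ_of_adj {r : ℕ} {x y : V} (hx : x ∈ ballIn G S v r) (hy : y ∈ S)
    (hxy : G.Adj x y) : y ∈ ballIn G S v (r + 1) := by
  classical
  exact Finset.mem_union_right _ (Finset.mem_filter.mpr ⟨hy, x, hx, hxy⟩)

/-- A ball has a spanning tree of depth at most its radius. -/
lemma exists_tree_ballIn [Finite V] (G : SimpleGraph V) (S : Finset V) (v : V) (r : ℕ) :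
    ∃ T : SimpleGraph V, T ≤ G ∧ T.edgeSet.ncard + 1 ≤ (ballIn G S v r).card ∧
      ∀ x ∈ ballIn G S v r, ∃ p : T.Walk v x, p.length ≤ r := by
  classical
  induction r with
  | zero =>
    refine ⟨⊥, bot_le, by simp [ballIn], fun x hx => ?_⟩
    obtain rfl := Finset.mem_singleton.mp hx
    exact ⟨Walk.nil, le_rfl⟩
  | succ r ih =>
    obtain ⟨T, hTG, hcard, hwalk⟩ := ih
    obtain ⟨T', hTT', hT'G, hcard', hwalk'⟩ := exists_extension_of_adj hTG
      (v := v) (r := r) (ballIn G S v (r + 1) \ ballIn G S v r) (by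
        intro y hy
        obtain ⟨hy, hyr⟩ := Finset.mem_sdiff.mp hy
        obtain ⟨-, x, hx, hxy⟩ :=
          Finset.mem_filter.mp ((Finset.mem_union.mp hy).resolve_left hyr)
        exact ⟨x, hxy, hwalk x hx⟩)
    refine ⟨T', hT'G, ?_, fun x hx => ?_⟩
    · have := Finset.card_sdiff_add_card_eq_card (ballIn_subset_succ (G := G) (S := S) (v := v) r)
      omega
    · by_cases hxr : x ∈ ballIn G S v r
      · obtain ⟨p, hp⟩ := hwalk x hxr
        exact ⟨p.mapLe hTT', by simpa using hp.trans r.le_succ⟩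
      · exact hwalk' x (Finset.mem_sdiff.mpr ⟨hx, hxr⟩)

/-- If `q ^ (K + 1)` is at least the size of `S`, some ball of radius at most `K` grows by a
factor of at most `q` in the next step. -/
lemma exists_card_ballIn_succ_le {q : ℝ} (hq : 0 ≤ q) {K : ℕ} (hv : v ∈ S)
    (hK : (S.card : ℝ) ≤ q ^ (K + 1)) :
    ∃ r ≤ K, ((ballIn G S v (r + 1)).card : ℝ) ≤ q * (ballIn G S v r).card := by
  by_contra! h
  have growth : ∀ r ≤ K, q ^ (r + 1) < ((ballIn G S v (r + 1)).card : ℝ) := by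
    intro r
    induction r with
    | zero => intro hr; simpa [ballIn] using h 0 hr
    | succ r ih =>
      intro hr
      calc q ^ (r + 1 + 1) = q * q ^ (r + 1) := pow_succ' _ _
        _ ≤ q * (ballIn G S v (r + 1)).card :=
          mul_le_mul_of_nonneg_left (ih (by omega)).le hq
        _ < _ := h _ hr
  have hS : ((ballIn G S v (K + 1)).card : ℝ) ≤ S.card :=
    mod_cast Finset.card_le_card (ballIn_subset hv _)
  linarith [growth K le_rfl]

end ballIn

/-- Ball growing: repeatedly carve out a slowly growing ball, keeping a spanning tree of the
ball of radius one larger. -/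
lemma exists_sparse_subgraph_of_card_le_pow {V : Type*} [Finite V] (G : SimpleGraph V) {q : ℝ}
    (hq : 0 ≤ q) {K : ℕ} (S : Finset V) (hK : (S.card : ℝ) ≤ q ^ (K + 1)) :
    ∃ H : SimpleGraph V, H ≤ G ∧ (H.edgeSet.ncard : ℝ) ≤ q * S.card ∧
      ∀ x ∈ S, ∀ y ∈ S, G.Adj x y → ∃ p : H.Walk x y, p.length ≤ 2 * (K + 1) := by
  classical
  induction S using Finset.strongInduction with
  | H S ih =>
    obtain rfl | ⟨v, hv⟩ := S.eq_empty_or_nonempty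
    · exact ⟨⊥, bot_le, by simp, by simp⟩
    obtain ⟨r, hrK, hr⟩ := exists_card_ballIn_succ_le (G := G) hq hv hK
    obtain ⟨T, hTG, hTcard, hTwalk⟩ := exists_tree_ballIn G S v (r + 1)
    have hBS : ballIn G S v r ⊆ S := ballIn_subset hv r
    have hcard := Finset.card_sdiff_add_card_eq_card hBS
    obtain ⟨H, hHG, hHcard, hHwalk⟩ := ih (S \ ballIn G S v r)
      (Finset.sdiff_ssubset hBS ⟨v, mem_ballIn_self r⟩)
      (le_trans (mod_cast Finset.card_le_card Finset.sdiff_subset) hK)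
    have hball : ∀ x ∈ ballIn G S v (r + 1), ∀ y ∈ ballIn G S v (r + 1),
        ∃ p : (T ⊔ H).Walk x y, p.length ≤ 2 * (K + 1) := by
      intro x hx y hy
      obtain ⟨p, hp⟩ := hTwalk x hx
      obtain ⟨p', hp'⟩ := hTwalk y hy
      refine ⟨(p.reverse.append p').mapLe le_sup_left, ?_⟩
      simp only [Walk.length_map, Walk.length_append, Walk.length_reverse]
      omega
    refine ⟨T ⊔ H, sup_le hTG hHG, ?_, fun x hx y hy hxy => ?_⟩
    · have hunion : (T ⊔ H).edgeSet.ncard ≤ T.edgeSet.ncard + H.edgeSet.ncard := by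
        rw [edgeSet_sup]
        exact Set.ncard_union_le _ _
      have hunion' : ((T ⊔ H).edgeSet.ncard : ℝ) ≤ T.edgeSet.ncard + H.edgeSet.ncard :=
        mod_cast hunion
      have hTcard' : (T.edgeSet.ncard : ℝ) + 1 ≤ (ballIn G S v (r + 1)).card := mod_cast hTcard
      have hS : (S.card : ℝ) = (S \ ballIn G S v r).card + (ballIn G S v r).card :=
        mod_cast hcard.symm
      rw [hS, mul_add]
      linarith
    · by_cases hxB : x ∈ ballIn G S v r
      · exact hball x (ballIn_subset_succ r hxB) y (mem_ballIn_succ_of_adj hxB hy hxy)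
      by_cases hyB : y ∈ ballIn G S v r
      · exact hball x (mem_ballIn_succ_of_adj hyB hx hxy.symm) y (ballIn_subset_succ r hyB)
      obtain ⟨p, hp⟩ := hHwalk x (Finset.mem_sdiff.mpr ⟨hx, hxB⟩) y
        (Finset.mem_sdiff.mpr ⟨hy, hyB⟩) hxy
      exact ⟨p.mapLe le_sup_right, by simpa using hp⟩

lemma wdist_one {V : Type*} (G : SimpleGraph V) (u v : V) :
    wdist G (fun _ => 1) u v = ⨅ p : G.Walk u v, (p.length : ENNReal) := by
  simp [wdist]

/-- A subgraph stretching every edge to at most `k` is an `α`-spanner for every `α ≥ k`. -/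
lemma isSpanner_of_forall_adj {V : Type*} {G H : SimpleGraph V} (hHG : H ≤ G) {k : ℕ} {α : ℝ}
    (hα : (k : ℝ) ≤ α) (hα0 : 0 < α)
    (h : ∀ x y, G.Adj x y → ∃ p : H.Walk x y, p.length ≤ k) :
    IsSpanner G H (fun _ => 1) α := by
  refine ⟨hHG, fun u v => ?_⟩
  have hwalk : ∀ {u v : V} (p : G.Walk u v), ∃ p' : H.Walk u v, p'.length ≤ k * p.length := by
    intro u v p
    induction p with
    | nil => exact ⟨Walk.nil, by simp⟩
    | cons hadj p ih =>
      obtain ⟨p₁, hp₁⟩ := h _ _ hadj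
      obtain ⟨p₂, hp₂⟩ := ih
      refine ⟨p₁.append p₂, ?_⟩
      rw [Walk.length_append, Walk.length_cons, mul_add]
      omega
  have hk : (k : ENNReal) ≤ ENNReal.ofReal α := by
    rw [← ENNReal.ofReal_natCast]
    exact ENNReal.ofReal_le_ofReal hα
  rw [wdist_one, wdist_one,
    ENNReal.mul_iInf_of_ne (ENNReal.ofReal_pos.mpr hα0).ne' ENNReal.ofReal_ne_top]
  refine le_iInf fun p => ?_
  obtain ⟨p', hp'⟩ := hwalk p
  calc (⨅ q : H.Walk u v, (q.length : ENNReal)) ≤ p'.length := iInf_le _ p'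
    _ ≤ k * p.length := mod_cast hp'
    _ ≤ ENNReal.ofReal α * p.length := by gcongr

lemma natCast_le_one_add_inv_pow {t : ℝ} (ht : 1 ≤ t) {n : ℕ} (hn : 0 < n) :
    (n : ℝ) ≤ (1 + t⁻¹) ^ (⌊t * Real.logb 2 n⌋₊ + 1) := by
  have ht0 : 0 < t := by linarith
  have hn0 : (0 : ℝ) < n := mod_cast hn
  have hlog : 0 ≤ Real.logb 2 n := Real.logb_nonneg one_lt_two (mod_cast hn)
  have hinv : 0 < t⁻¹ := inv_pos.mpr ht0
  have hbern : (2 : ℝ) ≤ (1 + t⁻¹) ^ t := by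
    have := one_add_mul_self_le_rpow_one_add (s := t⁻¹) (by linarith) ht
    rw [mul_inv_cancel₀ ht0.ne'] at this
    linarith
  calc (n : ℝ) = 2 ^ Real.logb 2 n := (Real.rpow_logb two_pos (by norm_num) hn0).symm
    _ ≤ ((1 + t⁻¹) ^ t) ^ Real.logb 2 n := Real.rpow_le_rpow two_pos.le hbern hlog
    _ = (1 + t⁻¹) ^ (t * Real.logb 2 n) := (Real.rpow_mul (by positivity) _ _).symm
    _ ≤ (1 + t⁻¹) ^ ((⌊t * Real.logb 2 n⌋₊ + 1 : ℕ) : ℝ) := by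
      refine Real.rpow_le_rpow_of_exponent_le (by linarith) ?_
      push_cast
      exact (Nat.lt_floor_add_one _).le
    _ = _ := Real.rpow_natCast _ _

/-- for every real `t ≥ 1`, every connected unweighted graph on `n ≥ 2`
vertices has an ultra-sparse spanner with at most `n + n/t` edges and stretch
`O(t · log n · 2^(log* n))`. -/
theorem exists_ultrasparse_spanner_unweighted :
    ∃ C : ℝ, 0 < C ∧
      ∀ (t : ℝ), 1 ≤ t →
        ∀ (n : ℕ), 2 ≤ n →
          ∀ (G : SimpleGraph (Fin n)), G.Connected →
            ∃ H : SimpleGraph (Fin n),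
              IsSpanner G H (fun _ => 1)
                (C * t * Real.logb 2 n * (2 : ℝ) ^ logStar (n : ℝ)) ∧
              (H.edgeSet.ncard : ℝ) ≤ n + n / t := by
  refine ⟨4, by norm_num, fun t ht n hn G _ => ?_⟩
  have ht0 : 0 < t := by linarith
  have hlog : 1 ≤ Real.logb 2 n := by
    rw [Real.le_logb_iff_rpow_le one_lt_two (by positivity), Real.rpow_one]
    exact mod_cast hn
  have htlog : 1 ≤ t * Real.logb 2 n := one_le_mul_of_one_le_of_one_le ht hlog
  have hpow : (1 : ℝ) ≤ 2 ^ logStar (n : ℝ) := one_le_pow₀ one_le_two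
  obtain ⟨H, hHG, hcard, hwalk⟩ := exists_sparse_subgraph_of_card_le_pow G
    (q := 1 + t⁻¹) (by positivity) Finset.univ
    (by simpa using natCast_le_one_add_inv_pow ht (by omega : 0 < n))
  have hstretch : 4 * (t * Real.logb 2 n) ≤ 4 * t * Real.logb 2 n * 2 ^ logStar (n : ℝ) := by
    rw [mul_assoc 4 t]
    exact le_mul_of_one_le_right (by positivity) hpow
  refine ⟨H, isSpanner_of_forall_adj hHG ?_ (by linarith)
    fun x y => hwalk x (Finset.mem_univ x) y (Finset.mem_univ y), ?_⟩
  · have := Nat.floor_le (zero_le_one.trans htlog)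
    push_cast
    linarith
  · rw [Finset.card_univ, Fintype.card_fin] at hcard
    calc (H.edgeSet.ncard : ℝ) ≤ (1 + t⁻¹) * n := hcard
      _ = n + n / t := by ring
end

section
/- There exists an absolute constant C with the following property. Let α ≥ 1 be real and let s : ℕ → ℝ be a nondecreasing function with s(N) ≥ 1 for all N. Suppose that every connected weighted graph on N vertices (for every N) admits an α-spanner with at most N·s(N) edges. Then for every real t ≥ 1, every connected weighted graph G on n vertices with positive edge weights admits a spanner with at most n + n/t edges and stretch at most C·t·s(n)·α. -/
open SimpleGraph

/-- `x` and `y` are joined in `F` by a walk with at most `L` edges, all of weight at most `W`. -/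
def LightReach {V : Type*} (F : SimpleGraph V) (w : Sym2 V → NNReal) (W : NNReal) (L : ℕ)
    (x y : V) : Prop :=
  ∃ p : F.Walk x y, p.length ≤ L ∧ ∀ e ∈ p.edges, w e ≤ W

namespace LightReach

variable {V : Type*} {F F' : SimpleGraph V} {w : Sym2 V → NNReal} {W W' : NNReal} {L L' : ℕ}
  {x y z : V}

theorem symm (h : LightReach F w W L x y) : LightReach F w W L y x := by
  obtain ⟨p, hp, hw⟩ := h
  exact ⟨p.reverse, by simpa using hp, by simpa using hw⟩

theorem trans (h : LightReach F w W L x y) (h' : LightReach F w W L' y z) :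
    LightReach F w W (L + L') x z := by
  obtain ⟨p, hp, hw⟩ := h
  obtain ⟨q, hq, hw'⟩ := h'
  refine ⟨p.append q, by rw [Walk.length_append]; omega, fun e he => ?_⟩
  rw [Walk.edges_append, List.mem_append] at he
  exact he.elim (hw e) (hw' e)

theorem mono (hF : F ≤ F') (hW : W ≤ W') (hL : L ≤ L') (h : LightReach F w W L x y) :
    LightReach F' w W' L' x y := by
  obtain ⟨p, hp, hw⟩ := h
  refine ⟨p.mapLe hF, by simpa using hp.trans hL, fun e he => ?_⟩
  rw [Walk.edges_mapLe_eq_edges] at he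
  exact (hw e he).trans hW

theorem of_adj (h : F.Adj x y) (hW : w s(x, y) ≤ W) : LightReach F w W 1 x y :=
  ⟨h.toWalk, by simp, by simpa using hW⟩

/-- A walk in a graph whose edges stay inside the fibres of `c` can be shortened to the size
of a fibre. -/
theorem shorten [Finite V] {c : V → V} (hc : ∀ a b, F.Adj a b → c a = c b) {M : ℕ}
    (hM : {a | c a = c x}.ncard ≤ M) (h : LightReach F w W L x y) :
    LightReach F w W M x y := by
  classical
  obtain ⟨p, -, hw⟩ := h
  have hsupp : ∀ {a b : V} (q : F.Walk a b), ∀ d ∈ q.support, c d = c a := by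
    intro a b q
    induction q with
    | nil => simp
    | cons h q ih =>
      intro d hd
      rw [Walk.support_cons, List.mem_cons] at hd
      rcases hd with rfl | hd
      · rfl
      · rw [ih d hd, hc _ _ h]
  refine ⟨p.bypass, ?_, fun e he => hw e (p.edges_bypass_subset_edges he)⟩
  have hnd := p.bypass_isPath.support_nodup
  have h1 : p.bypass.support.toFinset.card ≤ M := by
    rw [← Set.ncard_coe_finset]
    refine (Set.ncard_le_ncard (fun a ha => ?_) (Set.toFinite _)).trans hM
    exact hsupp p.bypass a (by simpa using ha)
  rw [List.toFinset_card_of_nodup hnd, Walk.length_support] at h1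
  omega

end LightReach

section WeightedDistance

variable {V : Type*} {G H : SimpleGraph V} {w : Sym2 V → NNReal} {x y z : V}

theorem wdist_le_walk (p : G.Walk x y) : wdist G w x y ≤ ((p.edges.map w).sum : NNReal) := by
  refine (iInf_le _ p).trans (le_of_eq ?_)
  induction p with
  | nil => simp
  | cons h p ih => simp_all

theorem le_wdist {a : ENNReal}
    (h : ∀ p : G.Walk x y, a ≤ ((p.edges.map w).sum : NNReal)) : a ≤ wdist G w x y := by
  refine le_iInf fun p => (h p).trans (le_of_eq ?_)
  clear h
  induction p with
  | nil => simp
  | cons h p ih => simp_all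

theorem wdist_self_eq_zero : wdist G w x x = 0 :=
  le_antisymm (by simpa using wdist_le_walk (w := w) (Walk.nil : G.Walk x x)) (zero_le)

theorem wdist_triangle_s6 : wdist G w x z ≤ wdist G w x y + wdist G w y z := by
  unfold wdist
  refine ENNReal.le_iInf_add_iInf fun p q => (iInf_le _ (p.append q)).trans (le_of_eq ?_)
  simp

theorem wdist_symm_le : wdist G w x y ≤ wdist G w y x :=
  le_wdist fun p => (wdist_le_walk p.reverse).trans (by simp)

theorem wdist_mono_graph (h : H ≤ G) : wdist G w x y ≤ wdist H w x y :=
  le_wdist fun p => (wdist_le_walk (p.mapLe h)).trans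
    (by rw [Walk.edges_mapLe_eq_edges])

theorem wdist_le_of_adj_s6 (h : G.Adj x y) : wdist G w x y ≤ w s(x, y) :=
  (wdist_le_walk h.toWalk).trans (by simp)

theorem LightReach.wdist_le {W : NNReal} {L : ℕ} (h : LightReach G w W L x y) :
    wdist G w x y ≤ L * W := by
  obtain ⟨p, hp, hw⟩ := h
  refine (wdist_le_walk p).trans ?_
  have h1 : (p.edges.map w).sum ≤ L * W := by
    have := List.sum_le_card_nsmul (p.edges.map w) W (by simpa using hw)
    rw [List.length_map, Walk.length_edges, nsmul_eq_mul] at this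
    refine this.trans ?_
    gcongr
  exact_mod_cast h1

/-- Distances along the edges of `G` control distances along its walks, possibly after moving
the vertices by `ρ`. -/
theorem wdist_le_mul_of_adj {U : Type*} {K : SimpleGraph U} {w' : Sym2 U → NNReal}
    {ρ : V → U} {B : ENNReal} (hB0 : B ≠ 0) (hB : B ≠ ⊤)
    (h : ∀ a b, G.Adj a b → wdist K w' (ρ a) (ρ b) ≤ B * w s(a, b)) (a b : V) :
    wdist K w' (ρ a) (ρ b) ≤ B * wdist G w a b := by
  have key : ∀ {a b : V} (p : G.Walk a b),
      wdist K w' (ρ a) (ρ b) ≤ B * ((p.edges.map w).sum : NNReal) := by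
    intro a b p
    induction p with
    | nil => rw [wdist_self_eq_zero]; exact zero_le
    | cons hab p ih =>
      refine wdist_triangle_s6.trans ((add_le_add (h _ _ hab) ih).trans (le_of_eq ?_))
      simp [mul_add]
  rw [mul_comm, ← ENNReal.div_le_iff hB0 hB]
  refine le_wdist fun p => ?_
  rw [ENNReal.div_le_iff hB0 hB, mul_comm]
  exact key p

end WeightedDistance

/-- A partition of the vertices into the fibres of the root map `c`, together with a sparse
subgraph `F` that connects vertices to their roots, and the ends of edges inside a fibre,
by short walks that are no heavier than the edges they serve. -/
structure IsClustering {V : Type*} (G : SimpleGraph V) (w : Sym2 V → NNReal) (L : ℕ)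
    (F : SimpleGraph V) (c : V → V) : Prop where
  idem : ∀ x, c (c x) = c x
  le : F ≤ G
  inside : ∀ x y, F.Adj x y → c x = c y
  reach_root : ∀ x y, G.Adj x y → c x ≠ c y → LightReach F w (w s(x, y)) L x (c x)
  reach_adj : ∀ x y, G.Adj x y → c x = c y → LightReach F w (w s(x, y)) L x y
  card_le : F.edgeSet.ncard + (Set.range c).ncard ≤ Nat.card V

namespace IsClustering

variable {V : Type*} {G F : SimpleGraph V} {w : Sym2 V → NNReal} {L : ℕ} {c : V → V}

theorem bot : IsClustering G w L ⊥ id where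
  idem _ := rfl
  le := bot_le
  inside _ _ h := h.elim
  reach_root x _ _ _ := ⟨Walk.nil, by simp, by simp⟩
  reach_adj x y h hc := (h.ne hc).elim
  card_le := by simp [Set.ncard_univ]

variable [Finite V]

theorem shorten (h : IsClustering G w L F c) {M : ℕ} (hM : ∀ r, {a | c a = r}.ncard ≤ M) :
    IsClustering G w M F c where
  idem := h.idem
  le := h.le
  inside := h.inside
  reach_root x y hxy hc := (h.reach_root x y hxy hc).shorten h.inside (hM _)
  reach_adj x y hxy hc := (h.reach_adj x y hxy hc).shorten h.inside (hM _)
  card_le := h.card_le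

/-- Merge every cluster with root in `S` along a lightest outgoing edge `s(u r, v r)` leading
to a cluster with root outside `S`. -/
theorem merge (h : IsClustering G w L F c) (S : Set V) (u v : V → V)
    (hadj : ∀ r ∈ S, G.Adj (u r) (v r)) (hu : ∀ r ∈ S, c (u r) = r)
    (hv : ∀ r ∈ S, c (v r) ∉ S)
    (hmin : ∀ r ∈ S, ∀ x y, G.Adj x y → c x = r → c y ≠ r → w s(u r, v r) ≤ w s(x, y)) :
    ∃ F' c', IsClustering G w (6 * L + 2) F' c' ∧
      (∀ x, c x ∈ S → c' x = c (v (c x))) ∧ (∀ x, c x ∉ S → c' x = c x) := by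
  classical
  set c' : V → V := fun x => if c x ∈ S then c (v (c x)) else c x with hc'
  set F' : SimpleGraph V := F ⊔ fromEdgeSet ((fun r => s(u r, v r)) '' S) with hF'
  have hin : ∀ x, c x ∈ S → c' x = c (v (c x)) := fun x hx => by simp [hc', hx]
  have hout : ∀ x, c x ∉ S → c' x = c x := fun x hx => by simp [hc', hx]
  have hFF : F ≤ F' := le_sup_left
  have hcong : ∀ x y, c x = c y → c' x = c' y := fun x y hxy => by simp [hc', hxy]
  have hnotS : ∀ x, c' x ∉ S := by
    intro x
    by_cases hx : c x ∈ S
    · rw [hin x hx]; exact hv _ hx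
    · rwa [hout x hx]
  have hne : ∀ r ∈ S, c (u r) ≠ c (v r) := fun r hr he => by
    rw [hu r hr] at he; exact hv r hr (he ▸ hr)
  have hnew : ∀ r ∈ S, F'.Adj (u r) (v r) := fun r hr =>
    Or.inr ((fromEdgeSet_adj _).2 ⟨⟨r, hr, rfl⟩, (hadj r hr).ne⟩)
  have key : ∀ x y, G.Adj x y → c x ≠ c y →
      LightReach F' w (w s(x, y)) (3 * L + 1) x (c' x) := by
    intro x y hxy hne'
    have h1 := h.reach_root x y hxy hne'
    by_cases hx : c x ∈ S
    · rw [hin x hx]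
      have hW := hmin _ hx x y hxy rfl hne'.symm
      have h2 := h.reach_root _ _ (hadj _ hx) (hne _ hx)
      have h3 := h.reach_root _ _ (hadj _ hx).symm (hne _ hx).symm
      rw [hu _ hx] at h2
      rw [Sym2.eq_swap] at h3
      exact ((((h1.mono hFF le_rfl le_rfl).trans (h2.symm.mono hFF hW le_rfl)).trans
        (LightReach.of_adj (hnew _ hx) hW)).trans (h3.mono hFF hW le_rfl)).mono le_rfl le_rfl
        (by omega)
    · rw [hout x hx]
      exact h1.mono hFF le_rfl (by omega)
  refine ⟨F', c', ⟨?_, ?_, ?_, ?_, ?_, ?_⟩, hin, hout⟩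
  · intro x
    have hcc : c (c' x) = c' x := by
      by_cases hx : c x ∈ S
      · rw [hin x hx, h.idem]
      · rw [hout x hx, h.idem]
    rw [hout (c' x) (hcc.symm ▸ hnotS x), hcc]
  · refine sup_le h.le fun x y hxy => ?_
    obtain ⟨⟨r, hr, he⟩, -⟩ := (fromEdgeSet_adj _).1 hxy
    have : s(u r, v r) ∈ G.edgeSet := hadj r hr
    rw [show s(u r, v r) = s(x, y) from he] at this
    exact this
  · rintro x y (hxy | hxy)
    · exact hcong _ _ (h.inside x y hxy)
    · obtain ⟨⟨r, hr, he⟩, -⟩ := (fromEdgeSet_adj _).1 hxy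
      have h1 : c' (u r) = c' (v r) := by
        rw [hin _ ((hu r hr).symm ▸ hr), hout _ (hv r hr), hu r hr]
      rcases Sym2.eq_iff.1 he with ⟨rfl, rfl⟩ | ⟨rfl, rfl⟩
      exacts [h1, h1.symm]
  · intro x y hxy hne'
    exact (key x y hxy fun he => hne' (hcong _ _ he)).mono le_rfl le_rfl (by omega)
  · intro x y hxy he'
    by_cases he : c x = c y
    · exact (h.reach_adj x y hxy he).mono hFF le_rfl (by omega)
    · have h1 := key x y hxy he
      have h2 := key y x hxy.symm (Ne.symm he)
      rw [Sym2.eq_swap, ← he'] at h2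
      exact (h1.trans h2.symm).mono le_rfl le_rfl (by omega)
  · have hS : S ⊆ Set.range c := fun r hr => ⟨u r, hu r hr⟩
    have h1 : (Set.range c').ncard ≤ (Set.range c \ S).ncard := by
      refine Set.ncard_le_ncard ?_ (Set.toFinite _)
      rintro _ ⟨x, rfl⟩
      refine ⟨?_, hnotS x⟩
      by_cases hx : c x ∈ S
      · rw [hin x hx]; exact ⟨_, rfl⟩
      · rw [hout x hx]; exact ⟨_, rfl⟩
    have h2 := Set.ncard_sdiff_add_ncard_of_subset hS (Set.toFinite _)
    have h3 : F'.edgeSet.ncard ≤ F.edgeSet.ncard + S.ncard := by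
      rw [hF', edgeSet_sup]
      refine (Set.ncard_union_le _ _).trans (add_le_add_right ?_ _)
      rw [edgeSet_fromEdgeSet]
      exact (Set.ncard_le_ncard Set.sdiff_subset (Set.toFinite _)).trans
        (Set.ncard_image_le (Set.toFinite _))
    have := h.card_le
    omega

end IsClustering

/-- A proper non-empty fibre has a lightest outgoing edge. -/
theorem exists_lightest_outgoing {V : Type*} [Finite V] {G : SimpleGraph V}
    (hG : G.Connected) (w : Sym2 V → NNReal) {c : V → V} {r x₀ y₀ : V} (hx₀ : c x₀ = r)
    (hy₀ : c y₀ ≠ r) :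
    ∃ u v, G.Adj u v ∧ c u = r ∧ c v ≠ r ∧
      ∀ x y, G.Adj x y → c x = r → c y ≠ r → w s(u, v) ≤ w s(x, y) := by
  obtain ⟨p⟩ := hG.preconnected x₀ y₀
  obtain ⟨d, -, hd1, hd2⟩ := p.exists_boundary_dart {a | c a = r} hx₀ hy₀
  let T : Set (V × V) := {q | G.Adj q.1 q.2 ∧ c q.1 = r ∧ c q.2 ≠ r}
  obtain ⟨q, hq, hmin⟩ := Set.exists_min_image T (fun q => w s(q.1, q.2)) (Set.toFinite _)
    ⟨(d.fst, d.snd), d.adj, hd1, hd2⟩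
  exact ⟨q.1, q.2, hq.1, hq.2.1, hq.2.2, fun x y h1 h2 h3 => hmin (x, y) ⟨h1, h2, h3⟩⟩

/-- Every connected weighted graph has a clustering with walks of length `O(k)` that either is
trivial or has at most `|V| / k` clusters. -/
theorem exists_clustering {V : Type*} [Finite V] {G : SimpleGraph V} (hG : G.Connected)
    (w : Sym2 V → NNReal) {k : ℕ} (hk : 1 ≤ k) :
    ∃ F c, IsClustering G w (14 * k) F c ∧
      ((Set.range c).ncard ≤ 1 ∨ k * (Set.range c).ncard ≤ Nat.card V) := by
  classical
  let P : ℕ → Prop := fun m => ∃ F c, IsClustering G w (2 * k) F c ∧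
    (∀ r, {a | c a = r}.ncard ≤ 2 * k) ∧ (Set.range c).ncard = m
  have hP : ∃ m, P m := by
    refine ⟨_, ⊥, id, IsClustering.bot, fun r => ?_, rfl⟩
    simp only [id, Set.ofPred_eq_eq_singleton, Set.ncard_singleton]
    omega
  obtain ⟨F, c, hc, hsize, hcard⟩ := Nat.find_spec hP
  have hleast := fun m => Nat.find_min' hP (m := m)
  rw [← hcard] at hleast
  by_cases htriv : (Set.range c).ncard ≤ 1
  · exact ⟨F, c, hc.shorten fun r => (hsize r).trans (by omega), Or.inl htriv⟩
  have hother : ∀ r, ∃ y, c y ≠ r := by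
    intro r
    by_contra! hcon
    refine htriv ((Set.ncard_le_ncard (t := {r}) ?_ (Set.toFinite _)).trans (by simp))
    rintro _ ⟨x, rfl⟩
    exact hcon x
  let S : Set V := {r | r ∈ Set.range c ∧ {a | c a = r}.ncard < k}
  have hex : ∀ r, ∃ u v, r ∈ S → G.Adj u v ∧ c u = r ∧ c v ≠ r ∧
      ∀ x y, G.Adj x y → c x = r → c y ≠ r → w s(u, v) ≤ w s(x, y) := by
    intro r
    by_cases hr : r ∈ S
    · obtain ⟨x₀, hx₀⟩ := hr.1
      obtain ⟨y₀, hy₀⟩ := hother r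
      obtain ⟨u, v, h⟩ := exists_lightest_outgoing hG w hx₀ hy₀
      exact ⟨u, v, fun _ => h⟩
    · exact ⟨r, r, fun h => (hr h).elim⟩
  choose u v huv using hex
  have hvS : ∀ r ∈ S, c (v r) ∉ S := by
    intro r hr hvr
    obtain ⟨h1, h2, h3, h4⟩ := huv r hr
    obtain ⟨F', c', hc', hin, hout⟩ := hc.merge {r} u v
      (by rintro _ rfl; exact h1) (by rintro _ rfl; exact h2) (by rintro _ rfl; exact h3)
      (by rintro _ rfl; exact h4)
    simp only [Set.mem_singleton_iff] at hin hout
    have hsize' : ∀ q, {a | c' a = q}.ncard ≤ 2 * k := by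
      intro q
      by_cases hq : q = c (v r)
      · have hsub : {a | c' a = q} ⊆ {a | c a = r} ∪ {a | c a = c (v r)} := by
          intro a ha
          by_cases har : c a = r
          · exact Or.inl har
          · exact Or.inr ((hout a har).symm.trans (ha.trans hq))
        have := (Set.ncard_le_ncard hsub (Set.toFinite _)).trans (Set.ncard_union_le _ _)
        have := hr.2
        have := hvr.2
        omega
      · refine (Set.ncard_le_ncard (fun a ha => ?_) (Set.toFinite _)).trans (hsize q)
        by_cases har : c a = r
        · exact (hq ((ha : c' a = q).symm.trans ((hin a har).trans (by rw [har])))).elim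
        · exact (hout a har).symm.trans ha
    have hle := hleast _ ⟨F', c', hc'.shorten hsize', hsize', rfl⟩
    have hlt : (Set.range c').ncard < (Set.range c).ncard := by
      refine Set.ncard_lt_ncard ⟨?_, fun hsub => ?_⟩ (Set.toFinite _)
      · rintro _ ⟨x, rfl⟩
        by_cases hx : c x = r
        · rw [hin x hx]; exact ⟨_, rfl⟩
        · rw [hout x hx]; exact ⟨_, rfl⟩
      · obtain ⟨x, hx⟩ := hsub hr.1
        by_cases hxr : c x = r
        · rw [hin x hxr, hxr] at hx; exact h3 hx
        · rw [hout x hxr] at hx; exact hxr hx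
    omega
  obtain ⟨F', c', hc', hin, hout⟩ := hc.merge S u v (fun r hr => (huv r hr).1)
    (fun r hr => (huv r hr).2.1) hvS (fun r hr => (huv r hr).2.2.2)
  refine ⟨F', c', ?_, Or.inr ?_⟩
  · refine ⟨hc'.idem, hc'.le, hc'.inside, fun x y h1 h2 => ?_, fun x y h1 h2 => ?_, hc'.card_le⟩
    · exact (hc'.reach_root x y h1 h2).mono le_rfl le_rfl (by omega)
    · exact (hc'.reach_adj x y h1 h2).mono le_rfl le_rfl (by omega)
  · have hbig : ∀ r ∈ Set.range c', k ≤ {a | c' a = r}.ncard := by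
      rintro _ ⟨x, rfl⟩
      have hx : c' x ∈ Set.range c ∧ c' x ∉ S := by
        by_cases hx : c x ∈ S
        · rw [hin x hx]; exact ⟨⟨_, rfl⟩, hvS _ hx⟩
        · rw [hout x hx]; exact ⟨⟨_, rfl⟩, hx⟩
      have hk' : k ≤ {a | c a = c' x}.ncard := by
        by_contra! hlt
        exact hx.2 ⟨hx.1, hlt⟩
      refine hk'.trans (Set.ncard_le_ncard (fun a ha => ?_) (Set.toFinite _))
      have ha' : c a = c' x := ha
      exact (hout a (ha' ▸ hx.2)).trans ha'
    have := Fintype.ofFinite V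
    have h1 := Finset.card_nsmul_le_sum (Finset.univ.image c')
      (fun r => (Finset.univ.filter fun a => c' a = r).card) k (by
        intro r hr
        have := hbig r (by simpa using hr)
        rwa [← Set.ncard_coe_finset, Finset.coe_filter_univ])
    rw [← Finset.card_eq_sum_card_image, Finset.card_univ, smul_eq_mul,
      ← Set.ncard_coe_finset, Finset.coe_image, Finset.coe_univ, Set.image_univ] at h1
    rw [Nat.card_eq_fintype_card, mul_comm]
    exact h1

/-- The image of `G` under `φ`, without loops. -/
def quotientGraph {V U : Type*} (G : SimpleGraph V) (φ : V → U) : SimpleGraph U :=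
  fromEdgeSet (Sym2.map φ '' G.edgeSet)

theorem quotientGraph_adj {V U : Type*} {G : SimpleGraph V} {φ : V → U} {x y : V}
    (h : G.Adj x y) (hne : φ x ≠ φ y) : (quotientGraph G φ).Adj (φ x) (φ y) :=
  (fromEdgeSet_adj _).2 ⟨⟨s(x, y), h, rfl⟩, hne⟩

theorem quotientGraph_connected {V U : Type*} {G : SimpleGraph V} (hG : G.Connected)
    {φ : V → U} (hφ : Function.Surjective φ) : (quotientGraph G φ).Connected := by
  have := hG.nonempty.map φ
  refine ⟨fun a b => ?_⟩
  obtain ⟨x, rfl⟩ := hφ a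
  obtain ⟨y, rfl⟩ := hφ b
  obtain ⟨p⟩ := hG.preconnected x y
  induction p with
  | nil => rfl
  | @cons x z _ h p ih =>
    by_cases he : φ x = φ z
    · rwa [he]
    · exact (quotientGraph_adj h he).reachable.trans ih

/-- Every edge of the quotient has a lightest preimage. -/
theorem exists_lightest_preimage {V U : Type*} [Finite V] [Nonempty V] (G : SimpleGraph V)
    (w : Sym2 V → NNReal) (φ : V → U) :
    ∃ rep : Sym2 U → Sym2 V, ∀ e ∈ (quotientGraph G φ).edgeSet,
      rep e ∈ G.edgeSet ∧ (rep e).map φ = e ∧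
        ∀ f ∈ G.edgeSet, f.map φ = e → w (rep e) ≤ w f := by
  have h : ∀ e : Sym2 U, ∃ f : Sym2 V, e ∈ (quotientGraph G φ).edgeSet →
      f ∈ G.edgeSet ∧ f.map φ = e ∧ ∀ f' ∈ G.edgeSet, f'.map φ = e → w f ≤ w f' := by
    intro e
    by_cases he : e ∈ (quotientGraph G φ).edgeSet
    · rw [quotientGraph, edgeSet_fromEdgeSet] at he
      obtain ⟨f₀, hf₀, hf₀e⟩ := he.1
      obtain ⟨f, hf, hmin⟩ := Set.exists_min_image {f | f ∈ G.edgeSet ∧ f.map φ = e} w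
        (Set.toFinite _) ⟨f₀, hf₀, hf₀e⟩
      exact ⟨f, fun _ => ⟨hf.1, hf.2, fun f' h1 h2 => hmin f' ⟨h1, h2⟩⟩⟩
    · exact ⟨s(Classical.arbitrary V, Classical.arbitrary V), fun h => (he h).elim⟩
  choose rep hrep using h
  exact ⟨rep, hrep⟩

/-- A spanner of the quotient by a clustering lifts to a spanner of the graph. -/
theorem IsClustering.isSpanner_lift {V U : Type*} {G F : SimpleGraph V}
    {w : Sym2 V → NNReal} {L : ℕ} {c : V → V} (h : IsClustering G w L F c)
    {φ : V → U} {ρ : U → V} (hρφ : ∀ x, ρ (φ x) = c x) (hφρ : ∀ a, φ (ρ a) = a)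
    {rep : Sym2 U → Sym2 V}
    (hrep : ∀ e ∈ (quotientGraph G φ).edgeSet, rep e ∈ G.edgeSet ∧ (rep e).map φ = e ∧
      ∀ f ∈ G.edgeSet, f.map φ = e → w (rep e) ≤ w f)
    {HQ : SimpleGraph U} {α : ℝ} (hα : 1 ≤ α)
    (hHQ : IsSpanner (quotientGraph G φ) HQ (w ∘ rep) α) :
    IsSpanner G (F ⊔ fromEdgeSet (rep '' HQ.edgeSet)) w ((4 * L + 1) * α) := by
  set H : SimpleGraph V := F ⊔ fromEdgeSet (rep '' HQ.edgeSet) with hH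
  have hFH : F ≤ H := le_sup_left
  have hne : ∀ {x y}, φ x ≠ φ y → c x ≠ c y := fun {x y} hxy he => hxy (by
    rw [← hφρ (φ x), ← hφρ (φ y), hρφ, hρφ, he])
  have hroot : ∀ x y, G.Adj x y → φ x ≠ φ y →
      wdist H w x (ρ (φ x)) ≤ L * w s(x, y) := by
    intro x y hxy hn
    rw [hρφ]
    exact (wdist_mono_graph hFH).trans (h.reach_root x y hxy (hne hn)).wdist_le
  have hroot' : ∀ x y, G.Adj x y → φ x ≠ φ y →
      wdist H w (ρ (φ x)) x ≤ L * w s(x, y) := fun x y hxy hn =>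
    wdist_symm_le.trans (hroot x y hxy hn)
  have hstep : ∀ x y, H.Adj x y → G.Adj x y → φ x ≠ φ y →
      wdist H w (ρ (φ x)) (ρ (φ y)) ≤ ((2 * L + 1 : ℕ) : ENNReal) * w s(x, y) := by
    intro x y hHxy hxy hn
    have h1 := hroot' x y hxy hn
    have h2 := hroot y x hxy.symm hn.symm
    rw [Sym2.eq_swap] at h2
    have h3 := wdist_le_of_adj_s6 (w := w) hHxy
    refine (wdist_triangle_s6 (y := x)).trans ((add_le_add h1
      ((wdist_triangle_s6 (y := y)).trans (add_le_add h3 h2))).trans (le_of_eq ?_))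
    push_cast
    ring
  have hquot := wdist_le_mul_of_adj (G := HQ) (K := H) (w := w ∘ rep) (w' := w) (ρ := ρ)
    (B := ((2 * L + 1 : ℕ) : ENNReal)) (by simp) (ENNReal.natCast_ne_top _) (by
      intro a b hab
      obtain ⟨h1, h2, -⟩ := hrep s(a, b) (hHQ.1 hab)
      have hmem : rep s(a, b) ∈ rep '' HQ.edgeSet := ⟨_, hab, rfl⟩
      have hab' := hab.ne
      simp only [Function.comp]
      generalize rep s(a, b) = f at h1 h2 hmem
      induction f with | _ x y
      have hHxy : H.Adj x y := Or.inr ((fromEdgeSet_adj _).2 ⟨hmem, G.ne_of_adj h1⟩)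
      rw [Sym2.map_mk] at h2
      rcases Sym2.eq_iff.1 h2 with ⟨rfl, rfl⟩ | ⟨rfl, rfl⟩
      · exact hstep x y hHxy h1 hab'
      · exact wdist_symm_le.trans (hstep x y hHxy h1 hab'.symm))
  have hα0 : (0 : ℝ) ≤ α := by linarith
  have hα' : (1 : ENNReal) ≤ ENNReal.ofReal α := by simpa using hα
  have hB : ENNReal.ofReal ((4 * L + 1) * α) = (4 * L + 1) * ENNReal.ofReal α := by
    rw [ENNReal.ofReal_mul (by positivity)]
    congr 1
    rw [show (4 * L + 1 : ℝ) = ((4 * L + 1 : ℕ) : ℝ) by push_cast; ring, ENNReal.ofReal_natCast]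
    push_cast
    ring
  refine ⟨sup_le h.le fun x y hxy => ?_, ?_⟩
  · obtain ⟨⟨e, he, hexy⟩, -⟩ := (fromEdgeSet_adj _).1 hxy
    have h1 := (hrep e (edgeSet_mono hHQ.1 he)).1
    rw [hexy] at h1
    exact h1
  · refine wdist_le_mul_of_adj (ρ := id) (by simp; positivity) ENNReal.ofReal_ne_top
      fun x y hxy => ?_
    rw [hB]
    simp only [id]
    by_cases he : φ x = φ y
    · have h1 : wdist H w x y ≤ L * w s(x, y) := (wdist_mono_graph hFH).trans
        (h.reach_adj x y hxy (by rw [← hρφ, ← hρφ, he])).wdist_le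
      refine h1.trans (mul_le_mul_left ?_ _)
      calc (L : ENNReal) = L * 1 := (mul_one _).symm
        _ ≤ (4 * L + 1) * ENNReal.ofReal α := mul_le_mul' (by
            exact_mod_cast (by omega : L ≤ 4 * L + 1)) hα'
    · have hQ := quotientGraph_adj hxy he
      have h0 : wdist (quotientGraph G φ) (w ∘ rep) (φ x) (φ y) ≤ w s(x, y) := by
        refine (wdist_le_of_adj_s6 hQ).trans ?_
        exact_mod_cast (hrep _ hQ).2.2 s(x, y) hxy rfl
      have h1 : wdist H w (ρ (φ x)) (ρ (φ y)) ≤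
          ((2 * L + 1 : ℕ) : ENNReal) * (ENNReal.ofReal α * w s(x, y)) :=
        (hquot _ _).trans (mul_le_mul_right ((hHQ.2 _ _).trans (mul_le_mul_right h0 _)) _)
      have h2 := hroot x y hxy he
      have h3 := hroot' y x hxy.symm (Ne.symm he)
      rw [Sym2.eq_swap] at h3
      have h4 : (L : ENNReal) * w s(x, y) ≤ L * (ENNReal.ofReal α * w s(x, y)) := by
        refine mul_le_mul_right ?_ _
        calc (w s(x, y) : ENNReal) = 1 * w s(x, y) := (one_mul _).symm
          _ ≤ _ := mul_le_mul_left hα' _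
      refine (wdist_triangle_s6 (y := ρ (φ x))).trans ((add_le_add (h2.trans h4)
        ((wdist_triangle_s6 (y := ρ (φ y))).trans (add_le_add h1 (h3.trans h4)))).trans
        (le_of_eq ?_))
      push_cast
      ring

theorem IsSpanner.mono_stretch {V : Type*} {G H : SimpleGraph V} {w : Sym2 V → NNReal}
    {α β : ℝ} (h : IsSpanner G H w α) (hαβ : α ≤ β) : IsSpanner G H w β :=
  ⟨h.1, fun u v => (h.2 u v).trans (mul_le_mul_left (ENNReal.ofReal_le_ofReal hαβ) _)⟩

/-- reduction from ultra-sparse spanners to sparse spanners. If every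
connected weighted graph on `N` vertices has an `α`-spanner with at most `N·s(N)` edges,
then every connected weighted graph on `n` vertices has a spanner with at most `n + n/t`
edges and stretch at most `C·t·s(n)·α`. -/
theorem ultrasparse_of_sparse_spanner :
    ∃ C : ℝ, 0 < C ∧
      ∀ (α : ℝ), 1 ≤ α →
        ∀ (s : ℕ → ℝ), Monotone s → (∀ N, 1 ≤ s N) →
          (∀ (N : ℕ) (G : SimpleGraph (Fin N)) (w : Sym2 (Fin N) → NNReal),
            G.Connected → (∀ e ∈ G.edgeSet, 0 < w e) →
            ∃ H : SimpleGraph (Fin N),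
              IsSpanner G H w α ∧ (H.edgeSet.ncard : ℝ) ≤ N * s N) →
          ∀ (t : ℝ), 1 ≤ t →
            ∀ (n : ℕ) (G : SimpleGraph (Fin n)) (w : Sym2 (Fin n) → NNReal),
              G.Connected → (∀ e ∈ G.edgeSet, 0 < w e) →
              ∃ H : SimpleGraph (Fin n),
                IsSpanner G H w (C * t * s n * α) ∧
                (H.edgeSet.ncard : ℝ) ≤ n + n / t := by
  refine ⟨113, by norm_num, ?_⟩
  intro α hα s hs hs1 hsparse t ht n G w hG hw
  have hts : 1 ≤ t * s n := one_le_mul_of_one_le_of_one_le ht (hs1 n)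
  set k := ⌈t * s n⌉₊ with hk
  have hk1 : 1 ≤ k := Nat.one_le_iff_ne_zero.2 (by
    rw [hk, Ne, Nat.ceil_eq_zero]; linarith)
  have hkge : t * s n ≤ k := Nat.le_ceil _
  have hkle : (k : ℝ) ≤ 2 * (t * s n) := by
    have := Nat.ceil_lt_add_one (by linarith : 0 ≤ t * s n)
    linarith
  obtain ⟨F, c, hc, hN⟩ := exists_clustering hG w hk1
  set N := (Set.range c).ncard with hNdef
  have hNn : F.edgeSet.ncard + N ≤ n := by simpa using hc.card_le
  let e : Set.range c ≃ Fin N := Finite.equivFin (Set.range c)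
  let φ : Fin n → Fin N := fun x => e ⟨c x, x, rfl⟩
  let ρ : Fin N → Fin n := fun a => e.symm a
  have hρφ : ∀ x, ρ (φ x) = c x := fun x => by simp [ρ, φ]
  have hφρ : ∀ a, φ (ρ a) = a := by
    intro a
    obtain ⟨⟨_, x, rfl⟩, rfl⟩ := e.surjective a
    simp [ρ, φ, hc.idem]
  have := hG.nonempty
  obtain ⟨rep, hrep⟩ := exists_lightest_preimage G w φ
  obtain ⟨HQ, hHQ, hHQcard⟩ := hsparse N (quotientGraph G φ) (w ∘ rep)
    (quotientGraph_connected hG fun a => ⟨ρ a, hφρ a⟩) (fun f hf => hw _ (hrep f hf).1)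
  refine ⟨_, (hc.isSpanner_lift hρφ hφρ hrep hα hHQ).mono_stretch ?_, ?_⟩
  · refine mul_le_mul_of_nonneg_right ?_ (by linarith)
    push_cast
    linarith
  · have hcard : ((F ⊔ fromEdgeSet (rep '' HQ.edgeSet)).edgeSet.ncard : ℝ) ≤
        F.edgeSet.ncard + HQ.edgeSet.ncard := by
      norm_cast
      rw [edgeSet_sup, edgeSet_fromEdgeSet]
      refine (Set.ncard_union_le _ _).trans (add_le_add_right ?_ _)
      exact (Set.ncard_le_ncard Set.sdiff_subset (Set.toFinite _)).trans
        (Set.ncard_image_le (Set.toFinite _))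
    have hFn : (F.edgeSet.ncard : ℝ) ≤ n := by exact_mod_cast (by omega)
    have hHQn : (HQ.edgeSet.ncard : ℝ) ≤ n / t := by
      rcases hN with hN | hN
      · have hsub : Subsingleton (Fin N) := Fin.subsingleton_iff_le_one.2 hN
        have : HQ.edgeSet = ∅ := by
          rw [Subsingleton.elim HQ ⊥, edgeSet_bot]
        rw [this, Set.ncard_empty, Nat.cast_zero]
        positivity
      · rw [le_div_iff₀ (by linarith)]
        have h1 : (k : ℝ) * N ≤ n := by exact_mod_cast (by simpa using hN)
        have h2 : s N ≤ s n := hs (by omega)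
        calc (HQ.edgeSet.ncard : ℝ) * t ≤ N * s N * t :=
              mul_le_mul_of_nonneg_right hHQcard (by linarith)
          _ ≤ N * s n * t := by gcongr
          _ = (t * s n) * N := by ring
          _ ≤ k * N := by gcongr
          _ ≤ n := h1
    linarith
end

section
/- For every connected weighted graph G on n vertices with positive edge weights and every integer t with 1 ≤ t ≤ n, there exists a stretch-friendly partition of the vertex set of G into clusters such that every cluster has size at least t (hence there are at most n/t clusters) and every cluster is equipped with a rooted spanning tree, consisting of edges of G, of radius at most 6t. -/
open SimpleGraph

/-- A cluster of a graph `G`: a set `carrier` of vertices together with a rooted spanning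
tree of the cluster consisting of edges of `G`. -/
structure RootedCluster {V : Type*} (G : SimpleGraph V) where
  carrier : Set V
  tree : SimpleGraph V
  root : V
  root_mem : root ∈ carrier
  tree_le : tree ≤ G
  mem_of_adj : ∀ u v : V, tree.Adj u v → u ∈ carrier ∧ v ∈ carrier
  reach : ∀ v ∈ carrier, tree.Reachable v root
  acyclic : tree.IsAcyclic

/-- The rooted tree of the cluster has radius at most `r`: every vertex of the cluster is
joined to the root by a tree path with at most `r` edges. -/
def RootedCluster.RadiusLE {V : Type*} {G : SimpleGraph V} (K : RootedCluster G)
    (r : ℕ) : Prop :=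
  ∀ v ∈ K.carrier, ∃ p : K.tree.Walk v K.root, p.length ≤ r

/-- A cluster is stretch-friendly: for every boundary edge `{u, v}` (with `v` inside,
`u` outside) every edge on the tree path from `v` to the root weighs at most `w s(u, v)`,
and for every inside edge `{u, v}` every edge on the tree path between `u` and `v` weighs
at most `w s(u, v)`. -/
def RootedCluster.StretchFriendly {V : Type*} {G : SimpleGraph V} (K : RootedCluster G)
    (w : Sym2 V → NNReal) : Prop :=
  (∀ u v : V, G.Adj u v → v ∈ K.carrier → u ∉ K.carrier →
    ∀ p : K.tree.Path v K.root, ∀ e ∈ p.1.edges, w e ≤ w s(u, v)) ∧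
  (∀ u v : V, G.Adj u v → u ∈ K.carrier → v ∈ K.carrier →
    ∀ p : K.tree.Path u v, ∀ e ∈ p.1.edges, w e ≤ w s(u, v))

section StretchForest

variable {V α : Type*} [LinearOrder α] {G F : SimpleGraph V} {w : Sym2 V → α} {ρ : V → V}

/-- The edges of `F` of weight at most `W`. -/
def lightSubgraph (F : SimpleGraph V) (w : Sym2 V → α) (W : α) : SimpleGraph V where
  Adj u v := F.Adj u v ∧ w s(u, v) ≤ W
  symm := ⟨fun u v h => ⟨h.1.symm, by simpa [Sym2.eq_swap] using h.2⟩⟩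
  loopless := ⟨fun v h => F.loopless.irrefl v h.1⟩

theorem lightSubgraph_le (W : α) : lightSubgraph F w W ≤ F := fun _ _ h => h.1

theorem lightSubgraph_mono {F' : SimpleGraph V} {W W' : α} (hF : F ≤ F') (hW : W ≤ W') :
    lightSubgraph F w W ≤ lightSubgraph F' w W' :=
  fun _ _ h => ⟨hF h.1, h.2.trans hW⟩

/-- In a forest, the path between two vertices joined by light edges is light. -/
theorem le_of_mem_edges_of_lightSubgraph_reachable (hF : F.IsAcyclic) {u v : V} {W : α}
    (h : (lightSubgraph F w W).Reachable u v) {p : F.Walk u v} (hp : p.IsPath)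
    {e : Sym2 V} (he : e ∈ p.edges) : w e ≤ W := by
  obtain ⟨q, hq⟩ := h.exists_isPath
  have hpq : p = q.mapLe (lightSubgraph_le W) :=
    congrArg Subtype.val <| (hF.subsingleton_path u v).elim
      ⟨p, hp⟩ ⟨_, hq.mapLe (lightSubgraph_le W)⟩
  rw [hpq, Walk.edges_mapLe_eq_edges] at he
  have := q.edges_subset_edgeSet he
  induction e with
  | h a b => exact this.2

/-- A spanning forest `F` of `G`, whose components are the fibres of the root map `ρ`, such that
every component, rooted at its value of `ρ`, is stretch-friendly. -/
structure IsStretchForest (G F : SimpleGraph V) (w : Sym2 V → α) (ρ : V → V) : Prop where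
  le : F ≤ G
  acyclic : F.IsAcyclic
  reachable : ∀ v, F.Reachable v (ρ v)
  root_eq : ∀ u v, F.Adj u v → ρ u = ρ v
  inner : ∀ u v, G.Adj u v → ρ u = ρ v → (lightSubgraph F w (w s(u, v))).Reachable u v
  outer : ∀ u v, G.Adj u v → ρ u ≠ ρ v → (lightSubgraph F w (w s(u, v))).Reachable u (ρ u)

theorem isStretchForest_bot : IsStretchForest G ⊥ w id where
  le := bot_le
  acyclic := isAcyclic_bot
  reachable _ := Reachable.rfl
  root_eq _ _ h := h.elim
  inner _ _ h e := (h.ne e).elim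
  outer _ _ _ _ := Reachable.rfl

/-- `s(x, y)` is an edge of minimum weight leaving the fibre of `ρ` through `x`. -/
structure IsMinOutgoing (G : SimpleGraph V) (w : Sym2 V → α) (ρ : V → V) (x y : V) : Prop where
  adj : G.Adj x y
  ne : ρ x ≠ ρ y
  min : ∀ a b, G.Adj a b → ρ a = ρ x → ρ b ≠ ρ x → w s(x, y) ≤ w s(a, b)

theorem exists_isMinOutgoing [Finite V] (hG : G.Connected) {v b : V} (hb : ρ b ≠ ρ v) :
    ∃ x y, ρ x = ρ v ∧ IsMinOutgoing G w ρ x y := by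
  let S : Set (V × V) := {d | G.Adj d.1 d.2 ∧ ρ d.1 = ρ v ∧ ρ d.2 ≠ ρ v}
  have hS : S.Nonempty := by
    obtain ⟨p⟩ := hG.preconnected v b
    obtain ⟨d, -, h1, h2⟩ := p.exists_boundary_dart {u | ρ u = ρ v} rfl hb
    exact ⟨(d.fst, d.snd), d.adj, h1, h2⟩
  obtain ⟨⟨x, y⟩, ⟨hxy, hx, hy⟩, hmin⟩ :=
    Set.exists_min_image S (fun d => w s(d.1, d.2)) (Set.toFinite S) hS
  refine ⟨x, y, hx, hxy, fun h => hy (h.symm.trans hx), fun a b hab ha hb => ?_⟩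
  exact hmin (a, b) ⟨hab, ha.trans hx, fun h => hb (h.trans hx.symm)⟩

open Classical in
/-- The root map after merging the fibre through `x` into the fibre through `y`. -/
noncomputable def mergeRoot (ρ : V → V) (x y : V) : V → V :=
  fun v => if ρ v = ρ x then ρ y else ρ v

theorem mergeRoot_of_eq {x y v : V} (h : ρ v = ρ x) : mergeRoot ρ x y v = ρ y := if_pos h

theorem mergeRoot_of_ne {x y v : V} (h : ρ v ≠ ρ x) : mergeRoot ρ x y v = ρ v := if_neg h

theorem mergeRoot_congr {x y u v : V} (h : ρ u = ρ v) :
    mergeRoot ρ x y u = mergeRoot ρ x y v := by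
  simp only [mergeRoot]
  rw [h]

theorem ncard_range_mergeRoot_lt [Finite V] {x y : V}
    (hxy : ρ x ≠ ρ y) : (Set.range (mergeRoot ρ x y)).ncard < (Set.range ρ).ncard := by
  refine Set.ncard_lt_ncard ⟨?_, fun hsub => ?_⟩ (Set.toFinite _)
  · rintro _ ⟨v, rfl⟩
    by_cases hv : ρ v = ρ x
    · exact ⟨y, (mergeRoot_of_eq hv).symm⟩
    · exact ⟨v, (mergeRoot_of_ne hv).symm⟩
  · obtain ⟨v, hv⟩ := hsub ⟨x, rfl⟩
    by_cases hvx : ρ v = ρ x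
    · exact hxy (hv.symm.trans (mergeRoot_of_eq hvx))
    · exact hvx ((mergeRoot_of_ne hvx).symm.trans hv)

theorem ncard_fiber_le_mergeRoot [Finite V] (x y v : V) :
    {z | ρ z = ρ v}.ncard ≤ {z | mergeRoot ρ x y z = mergeRoot ρ x y v}.ncard :=
  Set.ncard_le_ncard (fun _ hz => mergeRoot_congr hz) (Set.toFinite _)

theorem mergeRoot_eq_iff_of_ne {x y v z : V} (hvx : ρ v ≠ ρ x) (hvy : ρ v ≠ ρ y) :
    mergeRoot ρ x y z = mergeRoot ρ x y v ↔ ρ z = ρ v := by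
  refine ⟨fun hz => ?_, mergeRoot_congr⟩
  rw [mergeRoot_of_ne hvx] at hz
  by_cases hzx : ρ z = ρ x
  · exact absurd (hz.symm.trans (mergeRoot_of_eq hzx)) hvy
  · rwa [mergeRoot_of_ne hzx] at hz

theorem ncard_fiber_mergeRoot_of_ne {x y v : V} (hvx : ρ v ≠ ρ x) (hvy : ρ v ≠ ρ y) :
    {z | mergeRoot ρ x y z = mergeRoot ρ x y v}.ncard = {z | ρ z = ρ v}.ncard := by
  simp only [mergeRoot_eq_iff_of_ne hvx hvy]

theorem ncard_fiber_mergeRoot_le [Finite V] {x y v : V} (hv : mergeRoot ρ x y v = ρ y) :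
    {z | mergeRoot ρ x y z = mergeRoot ρ x y v}.ncard ≤
      {z | ρ z = ρ x}.ncard + {z | ρ z = ρ y}.ncard := by
  refine (Set.ncard_le_ncard (fun z hz => ?_) (Set.toFinite _)).trans (Set.ncard_union_le _ _)
  have hz : mergeRoot ρ x y z = ρ y := Eq.trans hz hv
  by_cases hzx : ρ z = ρ x
  · exact Or.inl hzx
  · exact Or.inr ((mergeRoot_of_ne hzx).symm.trans hz)

namespace IsStretchForest

theorem root_eq_of_reachable (h : IsStretchForest G F w ρ) {u v : V} (huv : F.Reachable u v) :
    ρ u = ρ v := by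
  obtain ⟨p⟩ := huv
  induction p with
  | nil => rfl
  | cons ha _ ih => exact (h.root_eq _ _ ha).trans ih

theorem root_root (h : IsStretchForest G F w ρ) (v : V) : ρ (ρ v) = ρ v :=
  (h.root_eq_of_reachable (h.reachable v)).symm

theorem merge (h : IsStretchForest G F w ρ) {x y : V} (hxy : IsMinOutgoing G w ρ x y) :
    IsStretchForest G (F ⊔ edge x y) w (mergeRoot ρ x y) := by
  have hadj : (F ⊔ edge x y).Adj x y := Or.inr ((edge_adj ..).2 ⟨Or.inl ⟨rfl, rfl⟩, hxy.adj.ne⟩)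
  have hle : F ≤ F ⊔ edge x y := le_sup_left
  have cross : ∀ u v, G.Adj u v → ρ u = ρ x → ρ v ≠ ρ x →
      (lightSubgraph (F ⊔ edge x y) w (w s(u, v))).Reachable u (ρ y) := by
    intro u v huv hu hv
    have hW := hxy.min u v huv hu hv
    have h1 := h.outer u v huv (fun e => hv (e.symm.trans hu))
    have h2 := h.outer x y hxy.adj hxy.ne
    have h3 := h.outer y x hxy.adj.symm hxy.ne.symm
    rw [Sym2.eq_swap] at h3
    rw [hu] at h1
    refine (h1.mono (lightSubgraph_mono hle le_rfl)).trans
      ((h2.mono (lightSubgraph_mono hle hW)).symm.trans ?_)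
    exact (Adj.reachable (G := lightSubgraph _ _ _) ⟨hadj, hW⟩).trans
      (h3.mono (lightSubgraph_mono hle hW))
  have inner : ∀ u v, G.Adj u v → ρ u = ρ x → ρ v ≠ ρ x → ρ v = ρ y →
      (lightSubgraph (F ⊔ edge x y) w (w s(u, v))).Reachable u v := by
    intro u v huv hu hv hvy
    have h1 := h.outer v u huv.symm (fun e => hv (e.trans hu))
    rw [Sym2.eq_swap, hvy] at h1
    exact (cross u v huv hu hv).trans (h1.mono (lightSubgraph_mono hle le_rfl)).symm
  refine ⟨?_, ?_, ?_, ?_, ?_, ?_⟩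
  · refine sup_le h.le fun a b hab => ?_
    rcases ((edge_adj ..).1 hab).1 with ⟨rfl, rfl⟩ | ⟨rfl, rfl⟩
    · exact hxy.adj
    · exact hxy.adj.symm
  · exact h.acyclic.sup_edge_of_not_reachable fun hr => hxy.ne (h.root_eq_of_reachable hr)
  · intro v
    by_cases hv : ρ v = ρ x
    · rw [mergeRoot_of_eq hv]
      have h1 := h.reachable v
      rw [hv] at h1
      exact ((h1.trans (h.reachable x).symm).mono hle).trans
        (hadj.reachable.trans ((h.reachable y).mono hle))
    · rw [mergeRoot_of_ne hv]
      exact (h.reachable v).mono hle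
  · rintro u v (huv | huv)
    · exact mergeRoot_congr (h.root_eq _ _ huv)
    · rcases ((edge_adj ..).1 huv).1 with ⟨rfl, rfl⟩ | ⟨rfl, rfl⟩
      · rw [mergeRoot_of_eq rfl, mergeRoot_of_ne hxy.ne.symm]
      · rw [mergeRoot_of_eq rfl, mergeRoot_of_ne hxy.ne.symm]
  · intro u v huv he
    by_cases hu : ρ u = ρ x <;> by_cases hv : ρ v = ρ x
    · exact (h.inner u v huv (hu.trans hv.symm)).mono (lightSubgraph_mono hle le_rfl)
    · rw [mergeRoot_of_eq hu, mergeRoot_of_ne hv] at he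
      exact inner u v huv hu hv he.symm
    · rw [mergeRoot_of_ne hu, mergeRoot_of_eq hv] at he
      rw [Sym2.eq_swap]
      exact (inner v u huv.symm hv hu he).symm
    · rw [mergeRoot_of_ne hu, mergeRoot_of_ne hv] at he
      exact (h.inner u v huv he).mono (lightSubgraph_mono hle le_rfl)
  · intro u v huv hne
    have hne' : ρ u ≠ ρ v := fun e => hne (mergeRoot_congr e)
    by_cases hu : ρ u = ρ x
    · rw [mergeRoot_of_eq hu]
      exact cross u v huv hu fun e => hne' (hu.trans e.symm)
    · rw [mergeRoot_of_ne hu]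
      exact (h.outer u v huv hne').mono (lightSubgraph_mono hle le_rfl)

theorem exists_walk_length_lt [Finite V] (h : IsStretchForest G F w ρ) {u v : V}
    (huv : ρ u = ρ v) : ∃ p : F.Walk u v, p.length < {z | ρ z = ρ u}.ncard := by
  classical
  have hr : F.Reachable u v :=
    (h.reachable u).trans (huv ▸ (h.reachable v).symm)
  obtain ⟨p, hp⟩ := hr.exists_isPath
  refine ⟨p, ?_⟩
  rw [Nat.lt_iff_add_one_le, ← Walk.length_support, ← List.toFinset_card_of_nodup hp.support_nodup,
    ← Set.ncard_coe_finset]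
  refine Set.ncard_le_ncard (fun z hz => ?_) (Set.toFinite _)
  have hz : z ∈ p.support := by simpa using hz
  exact (h.root_eq_of_reachable (p.takeUntil z hz).reachable).symm

/-- The fibre of `ρ` through `r`, with the part of `F` in it as a tree. -/
def toCluster (h : IsStretchForest G F w ρ) (r : V) (hr : ρ r = r) : RootedCluster G where
  carrier := {v | ρ v = r}
  tree :=
    { Adj := fun u v => F.Adj u v ∧ ρ u = r
      symm := ⟨fun u v huv => ⟨huv.1.symm, (h.root_eq _ _ huv.1).symm.trans huv.2⟩⟩
      loopless := ⟨fun v hv => F.loopless.irrefl v hv.1⟩ }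
  root := r
  root_mem := hr
  tree_le _ _ huv := h.le huv.1
  mem_of_adj u v huv := ⟨huv.2, (h.root_eq _ _ huv.1).symm.trans huv.2⟩
  reach v hv := by
    have hv : ρ v = r := hv
    obtain ⟨p⟩ := hv ▸ h.reachable v
    induction p with
    | nil => rfl
    | cons ha _ ih =>
      have hv' := (h.root_eq _ _ ha).symm.trans hv
      exact (Adj.reachable (G := SimpleGraph.mk _ _ _) ⟨ha, hv⟩).trans (ih hr hv' hv')
  acyclic := h.acyclic.anti fun _ _ huv => huv.1

theorem stretchFriendly_toCluster {w : Sym2 V → NNReal} (h : IsStretchForest G F w ρ) (r : V)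
    (hr : ρ r = r) : (h.toCluster r hr).StretchFriendly w := by
  have hle : (h.toCluster r hr).tree ≤ F := fun _ _ huv => huv.1
  refine ⟨fun u v huv hv hu p e he => ?_, fun u v huv hu hv p e he => ?_⟩
  · have hv : ρ v = r := hv
    have hu : ρ u ≠ r := hu
    have hl := h.outer v u huv.symm fun e => hu (e.symm.trans hv)
    rw [hv, Sym2.eq_swap] at hl
    exact le_of_mem_edges_of_lightSubgraph_reachable h.acyclic hl (p.2.mapLe hle)
      ((Walk.edges_mapLe_eq_edges hle p.1).symm ▸ he)
  · exact le_of_mem_edges_of_lightSubgraph_reachable h.acyclic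
      (h.inner u v huv (Eq.trans hu (Eq.symm hv))) (p.2.mapLe hle)
      ((Walk.edges_mapLe_eq_edges hle p.1).symm ▸ he)

theorem radiusLE_toCluster (h : IsStretchForest G F w ρ) {k : ℕ}
    (hk : ∀ v, ∃ p : F.Walk v (ρ v), p.length ≤ k) (r : V) (hr : ρ r = r) :
    (h.toCluster r hr).RadiusLE k := by
  have lift : ∀ {u v : V} (p : F.Walk u v), ρ u = r →
      ∃ q : (h.toCluster r hr).tree.Walk u v, q.length = p.length := by
    intro u v p
    induction p with
    | nil => exact fun _ => ⟨.nil, rfl⟩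
    | cons ha _ ih =>
      intro hu
      obtain ⟨q, hq⟩ := ih ((h.root_eq _ _ ha).symm.trans hu)
      exact ⟨.cons ⟨ha, hu⟩ q, congrArg (· + 1) hq⟩
  intro v hv
  have hv : ρ v = r := hv
  obtain ⟨p, hp⟩ := hk v
  obtain ⟨q, hq⟩ := lift p hv
  exact ⟨q.copy rfl hv, (Walk.length_copy q rfl hv).trans_le (hq.trans_le hp)⟩

/-- Merging small clusters along minimum outgoing edges into other small clusters, as long as
possible. -/
theorem exists_small_merged [Finite V] {t : ℕ} (h : IsStretchForest G F w ρ)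
    (hsize : ∀ v, {z | ρ z = ρ v}.ncard < 2 * t) :
    ∃ (F' : SimpleGraph V) (ρ' : V → V), IsStretchForest G F' w ρ' ∧
      (∀ v, {z | ρ' z = ρ' v}.ncard < 2 * t) ∧
      ∀ x y, IsMinOutgoing G w ρ' x y → {z | ρ' z = ρ' x}.ncard < t →
        t ≤ {z | ρ' z = ρ' y}.ncard := by
  induction hm : (Set.range ρ).ncard using Nat.strong_induction_on generalizing F ρ with
  | h m ih =>
    by_cases hdone : ∀ x y, IsMinOutgoing G w ρ x y → {z | ρ z = ρ x}.ncard < t →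
        t ≤ {z | ρ z = ρ y}.ncard
    · exact ⟨F, ρ, h, hsize, hdone⟩
    push Not at hdone
    obtain ⟨x, y, hxy, hx, hy⟩ := hdone
    refine ih _ (hm ▸ ncard_range_mergeRoot_lt hxy.ne) (h.merge hxy) (fun v => ?_) rfl
    by_cases hv : mergeRoot ρ x y v = ρ y
    · have := ncard_fiber_mergeRoot_le hv
      omega
    · have hvx : ρ v ≠ ρ x := fun e => hv (mergeRoot_of_eq e)
      have hvy : ρ v ≠ ρ y := fun e => hv ((mergeRoot_of_ne hvx).trans e)
      rw [ncard_fiber_mergeRoot_of_ne hvx hvy]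
      exact hsize v

/-- Attaching all small clusters to large ones, when each small cluster has a minimum outgoing
edge that ends close to the root of a large cluster. -/
theorem exists_large_merged [Finite V] {t : ℕ} (h : IsStretchForest G F w ρ)
    (hrad : ∀ v, ∃ p : F.Walk v (ρ v), p.length ≤ 6 * t)
    (hsmall : ∀ v, {z | ρ z = ρ v}.ncard < t → ∃ x y, ρ x = ρ v ∧ IsMinOutgoing G w ρ x y ∧
      t ≤ {z | ρ z = ρ y}.ncard ∧ ∃ p : F.Walk y (ρ y), p.length ≤ 2 * t) :
    ∃ (F' : SimpleGraph V) (ρ' : V → V), IsStretchForest G F' w ρ' ∧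
      (∀ v, ∃ p : F'.Walk v (ρ' v), p.length ≤ 6 * t) ∧
      ∀ v, t ≤ {z | ρ' z = ρ' v}.ncard := by
  induction hm : (Set.range ρ).ncard using Nat.strong_induction_on generalizing F ρ with
  | h m ih =>
    by_cases hdone : ∀ v, t ≤ {z | ρ z = ρ v}.ncard
    · exact ⟨F, ρ, h, hrad, hdone⟩
    push Not at hdone
    obtain ⟨v₀, hv₀⟩ := hdone
    obtain ⟨x, y, hxv, hxy, hy, p, hp⟩ := hsmall v₀ hv₀
    rw [← hxv] at hv₀
    have hle : F ≤ F ⊔ edge x y := le_sup_left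
    have hadj : (F ⊔ edge x y).Adj x y :=
      Or.inr ((edge_adj ..).2 ⟨Or.inl ⟨rfl, rfl⟩, hxy.adj.ne⟩)
    refine ih _ (hm ▸ ncard_range_mergeRoot_lt hxy.ne) (h.merge hxy) (fun v => ?_)
      (fun v hv => ?_) rfl
    · by_cases hvx : ρ v = ρ x
      · obtain ⟨q, hq⟩ := h.exists_walk_length_lt hvx
        rw [hvx] at hq
        rw [mergeRoot_of_eq hvx]
        refine ⟨(q.mapLe hle).append (.cons hadj (p.mapLe hle)), ?_⟩
        simp only [Walk.length_append, Walk.length_cons, Walk.length_mapLe]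
        omega
      · rw [mergeRoot_of_ne hvx]
        obtain ⟨q, hq⟩ := hrad v
        exact ⟨q.mapLe hle, by simpa only [Walk.length_mapLe] using hq⟩
    · have hmono := ncard_fiber_le_mergeRoot (ρ := ρ) x y y
      have hvy' : mergeRoot ρ x y v ≠ ρ y := fun e => by
        rw [mergeRoot_of_ne hxy.ne.symm] at hmono
        rw [e] at hv
        omega
      have hvx : ρ v ≠ ρ x := fun e => hvy' (mergeRoot_of_eq e)
      have hvy : ρ v ≠ ρ y := fun e => hvy' ((mergeRoot_of_ne hvx).trans e)
      rw [ncard_fiber_mergeRoot_of_ne hvx hvy] at hv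
      obtain ⟨a, b, hav, hab, hb, q, hq⟩ := hsmall v hv
      have hbx : ρ b ≠ ρ x := fun e => by
        rw [e] at hb
        omega
      have hiff : ∀ z, mergeRoot ρ x y z = mergeRoot ρ x y a ↔ ρ z = ρ a := fun z =>
        mergeRoot_eq_iff_of_ne (hav ▸ hvx) (hav ▸ hvy)
      refine ⟨a, b, mergeRoot_congr hav,
        ⟨hab.adj, fun e => hab.ne ((hiff b).1 e.symm).symm, fun c d hcd hc hd =>
          hab.min c d hcd ((hiff c).1 hc) fun e => hd ((hiff d).2 e)⟩,
        hb.trans (ncard_fiber_le_mergeRoot x y b), ?_⟩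
      rw [mergeRoot_of_ne hbx]
      exact ⟨q.mapLe hle, by simpa only [Walk.length_mapLe] using hq⟩

end IsStretchForest

theorem exists_isStretchForest [Finite V] (hG : G.Connected) {t : ℕ} (ht : 1 ≤ t)
    (htV : t ≤ Nat.card V) :
    ∃ (F : SimpleGraph V) (ρ : V → V), IsStretchForest G F w ρ ∧
      (∀ v, ∃ p : F.Walk v (ρ v), p.length ≤ 6 * t) ∧ ∀ v, t ≤ {z | ρ z = ρ v}.ncard := by
  obtain ⟨F, ρ, h, hsize, hmin⟩ :=
    (isStretchForest_bot (G := G) (w := w)).exists_small_merged (t := t) fun v => by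
      simp only [id, Set.ofPred_eq_eq_singleton, Set.ncard_singleton]
      omega
  have hrad : ∀ v, ∃ p : F.Walk v (ρ v), p.length ≤ 2 * t := fun v => by
    obtain ⟨p, hp⟩ := h.exists_walk_length_lt (h.root_root v).symm
    exact ⟨p, (hp.trans (hsize v)).le⟩
  refine h.exists_large_merged (fun v => (hrad v).imp fun p hp => by omega) fun v hv => ?_
  have hb : ∃ b, ρ b ≠ ρ v := by
    by_contra! hall
    simp only [hall, Set.ofPred_true, Set.ncard_univ] at hv
    omega
  obtain ⟨b, hb⟩ := hb
  obtain ⟨x, y, hx, hxy⟩ := exists_isMinOutgoing (w := w) hG hb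
  exact ⟨x, y, hx, hxy, hmin x y hxy (hx ▸ hv), hrad y⟩

end StretchForest

/-- every connected weighted graph on `n` vertices with positive edge
weights and every `1 ≤ t ≤ n` admit a stretch-friendly partition into clusters of size at
least `t` (hence at most `n/t` clusters), each with a rooted spanning tree of radius at
most `6t`. -/
theorem exists_stretchFriendly_partition (n : ℕ) (G : SimpleGraph (Fin n))
    (w : Sym2 (Fin n) → NNReal) (hG : G.Connected) (hw : ∀ e ∈ G.edgeSet, 0 < w e)
    (t : ℕ) (ht1 : 1 ≤ t) (htn : t ≤ n) :
    ∃ 𝒞 : Set (RootedCluster G),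
      (𝒞.Pairwise fun K₁ K₂ => Disjoint K₁.carrier K₂.carrier) ∧
      (⋃ K ∈ 𝒞, K.carrier) = Set.univ ∧
      (∀ K ∈ 𝒞, t ≤ K.carrier.ncard ∧ K.RadiusLE (6 * t) ∧ K.StretchFriendly w) := by
  obtain ⟨F, ρ, h, hrad, hsize⟩ := exists_isStretchForest (w := w) hG ht1 (by simpa using htn)
  refine ⟨Set.range fun v => h.toCluster (ρ v) (h.root_root v), ?_, ?_, ?_⟩
  · rintro _ ⟨u, rfl⟩ _ ⟨v, rfl⟩ hne
    refine Set.disjoint_left.2 fun z hu hv => hne ?_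
    have huv : ρ u = ρ v := (Eq.symm hu).trans hv
    simp only [huv]
  · exact Set.eq_univ_of_forall fun v => Set.mem_biUnion ⟨v, rfl⟩ rfl
  · rintro _ ⟨v, rfl⟩
    exact ⟨hsize v, h.radiusLE_toCluster hrad _ _, h.stretchFriendly_toCluster _ _⟩
end

section
/- Let G be a weighted graph with positive edge weights and let C₁ and C₂ be two disjoint stretch-friendly clusters of G with rooted spanning trees T₁ (rooted at root₁) and T₂ (rooted at root₂). Let e = {u₁,u₂} with u₁ ∈ C₁ and u₂ ∈ C₂ be an edge of G of minimum weight among all edges of G with exactly one endpoint in C₁. Then the cluster C₁ ∪ C₂ with rooted spanning tree T₁ ∪ T₂ ∪ {e}, rooted at root₂, is stretch-friendly. -/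
open SimpleGraph

namespace SimpleGraph

variable {V : Type*} {T T₁ T₂ : SimpleGraph V} {A B : Set V}

/-- In a forest, the edges of the path between two vertices weigh at most `c` iff the vertices
remain joined after all edges heavier than `c` are removed. -/
lemma IsAcyclic.forall_mem_edges_le_iff (hT : T.IsAcyclic) {w : Sym2 V → NNReal} {c : NNReal}
    {a b : V} (hab : T.Reachable a b) :
    (∀ p : T.Path a b, ∀ e ∈ p.1.edges, w e ≤ c) ↔
      (T.deleteEdges {e | c < w e}).Reachable a b := by
  classical
  constructor
  · intro h
    obtain ⟨q⟩ := hab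
    exact ⟨q.toPath.1.toDeleteEdges _ fun e he ↦ not_lt.2 (h q.toPath e he)⟩
  · rintro ⟨q⟩ p e he
    have hq : p = (q.mapLe (deleteEdges_le _)).toPath := (hT.subsingleton_path _ _).elim _ _
    rw [hq] at he
    have hmem := Walk.edges_toPath_subset_edges _ he
    rw [Walk.edges_mapLe_eq_edges] at hmem
    have hmem' := q.edges_subset_edgeSet hmem
    rw [edgeSet_deleteEdges] at hmem'
    exact not_lt.1 hmem'.2

/-- A walk in the union of two graphs living on disjoint vertex sets that starts in the first
set only uses edges of the first graph. -/
lemma Walk.edges_subset_left_of_disjoint (hAB : Disjoint A B)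
    (h₁ : ∀ u v, T₁.Adj u v → v ∈ A) (h₂ : ∀ u v, T₂.Adj u v → u ∈ B)
    {a b : V} (p : (T₁ ⊔ T₂).Walk a b) (ha : a ∈ A) :
    b ∈ A ∧ ∀ e ∈ p.edges, e ∈ T₁.edgeSet := by
  induction p with
  | nil => simpa using ha
  | cons h p ih =>
    have hadj : T₁.Adj _ _ :=
      h.resolve_right fun h' ↦ Set.disjoint_left.1 hAB ha (h₂ _ _ h')
    obtain ⟨hb, he⟩ := ih (h₁ _ _ hadj)
    refine ⟨hb, fun e hmem ↦ ?_⟩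
    rw [Walk.edges_cons, List.mem_cons] at hmem
    rcases hmem with rfl | hmem
    · exact hadj
    · exact he e hmem

/-- The union of two forests living on disjoint vertex sets is a forest. -/
lemma IsAcyclic.sup_of_disjoint (hAB : Disjoint A B)
    (h₁ : ∀ u v, T₁.Adj u v → u ∈ A ∧ v ∈ A) (h₂ : ∀ u v, T₂.Adj u v → u ∈ B ∧ v ∈ B)
    (hT₁ : T₁.IsAcyclic) (hT₂ : T₂.IsAcyclic) : (T₁ ⊔ T₂).IsAcyclic := by
  intro a p hp
  have key : ∀ {S₁ S₂ : SimpleGraph V} {A B : Set V}, Disjoint A B →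
      (∀ u v, S₁.Adj u v → u ∈ A ∧ v ∈ A) → (∀ u v, S₂.Adj u v → u ∈ B ∧ v ∈ B) →
      S₁.IsAcyclic → ∀ p : (S₁ ⊔ S₂).Walk a a, p.IsCycle → a ∉ A := by
    intro S₁ S₂ A B hd h₁ h₂ hS p hp ha
    have he := (p.edges_subset_left_of_disjoint hd (fun u v h ↦ (h₁ u v h).2)
      (fun u v h ↦ (h₂ u v h).1) ha).2
    exact hS _ (hp.transfer he)
  have hA := key hAB h₁ h₂ hT₁ p hp
  have hB := key hAB.symm h₂ h₁ hT₂ (p.mapLe (sup_comm T₁ T₂).le) (hp.mapLe _)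
  cases p with
  | nil => exact hp.ne_nil rfl
  | cons h _ => exact h.elim (fun h ↦ hA (h₁ _ _ h).1) fun h ↦ hB (h₂ _ _ h).1

end SimpleGraph

namespace RootedCluster

variable {V : Type*} {G : SimpleGraph V}

/-- A cluster is stretch-friendly iff the required vertices are joined in the tree after all
edges heavier than the given edge are removed. -/
lemma stretchFriendly_iff_reachable (K : RootedCluster G) (w : Sym2 V → NNReal) :
    K.StretchFriendly w ↔
      (∀ u v : V, G.Adj u v → v ∈ K.carrier → u ∉ K.carrier →
        (K.tree.deleteEdges {e | w s(u, v) < w e}).Reachable v K.root) ∧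
      (∀ u v : V, G.Adj u v → u ∈ K.carrier → v ∈ K.carrier →
        (K.tree.deleteEdges {e | w s(u, v) < w e}).Reachable u v) := by
  refine and_congr ?_ ?_
  · exact forall₄_congr fun u v _ hv ↦ forall_congr' fun _ ↦
      K.acyclic.forall_mem_edges_le_iff (K.reach v hv)
  · exact forall₄_congr fun u v _ hu ↦ forall_congr' fun hv ↦
      K.acyclic.forall_mem_edges_le_iff ((K.reach u hu).trans (K.reach v hv).symm)

/-- The union of two disjoint clusters joined by an edge of `G`, rooted at the root of the
second cluster. -/
def merge (K₁ K₂ : RootedCluster G) (hdisj : Disjoint K₁.carrier K₂.carrier) (u₁ u₂ : V)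
    (hu₁ : u₁ ∈ K₁.carrier) (hu₂ : u₂ ∈ K₂.carrier) (hadj : G.Adj u₁ u₂) :
    RootedCluster G where
  carrier := K₁.carrier ∪ K₂.carrier
  tree := K₁.tree ⊔ K₂.tree ⊔ SimpleGraph.fromEdgeSet {s(u₁, u₂)}
  root := K₂.root
  root_mem := Or.inr K₂.root_mem
  tree_le := by
    refine sup_le (sup_le K₁.tree_le K₂.tree_le) fun x y h ↦ ?_
    have hxy : s(x, y) = s(u₁, u₂) := ((fromEdgeSet_adj _).1 h).1
    rwa [← mem_edgeSet, hxy]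
  mem_of_adj u v h := by
    rcases h with (h | h) | h
    · exact (K₁.mem_of_adj u v h).imp Or.inl Or.inl
    · exact (K₂.mem_of_adj u v h).imp Or.inr Or.inr
    · have huv : s(u, v) = s(u₁, u₂) := ((fromEdgeSet_adj _).1 h).1
      rcases Sym2.eq_iff.1 huv with ⟨rfl, rfl⟩ | ⟨rfl, rfl⟩
      · exact ⟨Or.inl hu₁, Or.inr hu₂⟩
      · exact ⟨Or.inr hu₂, Or.inl hu₁⟩
  reach v hv := by
    have hle₁ : K₁.tree ≤ K₁.tree ⊔ K₂.tree ⊔ fromEdgeSet {s(u₁, u₂)} :=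
      le_sup_left.trans le_sup_left
    have hle₂ : K₂.tree ≤ K₁.tree ⊔ K₂.tree ⊔ fromEdgeSet {s(u₁, u₂)} :=
      le_sup_right.trans le_sup_left
    rcases hv with hv | hv
    · have he : (K₁.tree ⊔ K₂.tree ⊔ fromEdgeSet {s(u₁, u₂)}).Adj u₁ u₂ :=
        Or.inr ((fromEdgeSet_adj _).2 ⟨rfl, hadj.ne⟩)
      exact (((K₁.reach v hv).trans (K₁.reach u₁ hu₁).symm).mono hle₁).trans
        (he.reachable.trans ((K₂.reach u₂ hu₂).mono hle₂))
    · exact (K₂.reach v hv).mono hle₂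
  acyclic := by
    refine (IsAcyclic.sup_of_disjoint hdisj K₁.mem_of_adj K₂.mem_of_adj K₁.acyclic
      K₂.acyclic).sup_edge_of_not_reachable ?_
    rintro ⟨p⟩
    exact Set.disjoint_left.1 hdisj (p.edges_subset_left_of_disjoint hdisj
      (fun u v h ↦ (K₁.mem_of_adj u v h).2) (fun u v h ↦ (K₂.mem_of_adj u v h).1) hu₁).1 hu₂

end RootedCluster

/-- merging two disjoint stretch-friendly clusters along a minimum-weight
boundary edge of the first cluster (rooting the result at the root of the second cluster)
yields a stretch-friendly cluster. -/
theorem stretchFriendly_merge {V : Type*} (G : SimpleGraph V) (w : Sym2 V → NNReal)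
    (hw : ∀ e ∈ G.edgeSet, 0 < w e)
    (K₁ K₂ : RootedCluster G) (hdisj : Disjoint K₁.carrier K₂.carrier)
    (h₁ : K₁.StretchFriendly w) (h₂ : K₂.StretchFriendly w)
    (u₁ u₂ : V) (hu₁ : u₁ ∈ K₁.carrier) (hu₂ : u₂ ∈ K₂.carrier) (hadj : G.Adj u₁ u₂)
    (hmin : ∀ x y : V, G.Adj x y → x ∈ K₁.carrier → y ∉ K₁.carrier →
      w s(u₁, u₂) ≤ w s(x, y)) :
    ∃ K : RootedCluster G,
      K.carrier = K₁.carrier ∪ K₂.carrier ∧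
      K.tree = K₁.tree ⊔ K₂.tree ⊔ SimpleGraph.fromEdgeSet {s(u₁, u₂)} ∧
      K.root = K₂.root ∧
      K.StretchFriendly w := by
  have hnot₁ : ∀ {x}, x ∈ K₂.carrier → x ∉ K₁.carrier := fun h ↦ Set.disjoint_right.1 hdisj h
  have hnot₂ : ∀ {x}, x ∈ K₁.carrier → x ∉ K₂.carrier := fun h ↦ Set.disjoint_left.1 hdisj h
  refine ⟨K₁.merge K₂ hdisj u₁ u₂ hu₁ hu₂ hadj, rfl, rfl, rfl, ?_⟩
  rw [RootedCluster.stretchFriendly_iff_reachable] at h₁ h₂ ⊢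
  obtain ⟨hout₁, hin₁⟩ := h₁
  obtain ⟨hout₂, hin₂⟩ := h₂
  set T := (K₁.merge K₂ hdisj u₁ u₂ hu₁ hu₂ hadj).tree
  have hle₁ : K₁.tree ≤ T := le_sup_left.trans le_sup_left
  have hle₂ : K₂.tree ≤ T := le_sup_right.trans le_sup_left
  have hadjT : T.Adj u₁ u₂ := Or.inr ((fromEdgeSet_adj _).2 ⟨rfl, hadj.ne⟩)
  have cross : ∀ x y : V, G.Adj x y → x ∈ K₁.carrier → y ∉ K₁.carrier →
      (T.deleteEdges {e | w s(x, y) < w e}).Reachable x K₂.root := by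
    intro x y hxy hx hy
    have hc := hmin x y hxy hx hy
    have hsub : {e | w s(x, y) < w e} ⊆
      {e | w s(u₁, u₂) < w e} := fun e he ↦ hc.trans_lt he
    have hxr := hout₁ y x hxy.symm hx hy
    have hur := hout₁ u₂ u₁ hadj.symm hu₁ (hnot₁ hu₂)
    rw [Sym2.eq_swap] at hxr hur
    have he : (T.deleteEdges {e | w s(x, y) < w e}).Adj u₁ u₂ :=
      deleteEdges_adj.2 ⟨hadjT, not_lt.2 hc⟩
    have hu₂r := hout₂ u₁ u₂ hadj hu₂ (hnot₂ hu₁)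
    exact (hxr.mono (deleteEdges_mono hle₁)).trans <|
      (hur.mono ((deleteEdges_anti hsub).trans (deleteEdges_mono hle₁))).symm.trans <|
      he.reachable.trans (hu₂r.mono ((deleteEdges_anti hsub).trans (deleteEdges_mono hle₂)))
  have cross_in : ∀ x y : V, G.Adj x y → x ∈ K₁.carrier → y ∈ K₂.carrier →
      (T.deleteEdges {e | w s(x, y) < w e}).Reachable x y := fun x y hxy hx hy ↦
    (cross x y hxy hx (hnot₁ hy)).trans
      ((hout₂ x y hxy hy (hnot₂ hx)).mono (deleteEdges_mono hle₂)).symm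
  constructor
  · rintro u v huv (hv | hv) hu
    · rw [Sym2.eq_swap]
      exact cross v u huv.symm hv fun h ↦ hu (Or.inl h)
    · exact (hout₂ u v huv hv fun h ↦ hu (Or.inr h)).mono (deleteEdges_mono hle₂)
  · rintro u v huv (hu | hu) (hv | hv)
    · exact (hin₁ u v huv hu hv).mono (deleteEdges_mono hle₁)
    · exact cross_in u v huv hu hv
    · rw [Sym2.eq_swap]
      exact (cross_in v u huv.symm hv hu).symm
    · exact (hin₂ u v huv hu hv).mono (deleteEdges_mono hle₂)
end

section
/- There is a sufficiently large constant α₀ such that for every real α > α₀, setting x = α/log α, y = (log α)/(log log α), and z = y·(1 + 2·(log log y)/(log y)), one has x·log x ≤ α and α ≤ y^z. -/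
theorem logb_two_le_half {b : ℝ} (hb : 4 ≤ b) : Real.logb 2 b ≤ b / 2 := by
  have h2 : (1 / 2 : ℝ) < Real.log 2 := by linarith [Real.log_two_gt_d9]
  have hlog4 : Real.log 4 = 2 * Real.log 2 := by
    rw [show (4 : ℝ) = 2 ^ 2 by norm_num, Real.log_pow]
    norm_num
  have h := Real.log_le_sub_one_of_pos (show 0 < b / 4 by linarith)
  rw [Real.log_div (by linarith) (by norm_num), hlog4] at h
  rw [Real.logb, div_le_iff₀ (by linarith)]
  nlinarith

/-- there is a sufficiently large constant `α₀` such that for every real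
`α > α₀`, setting `x = α/log α`, `y = (log α)/(log log α)` and
`z = y·(1 + 2·(log log y)/(log y))` (logs in base 2), one has `x·log x ≤ α ≤ y^z`. -/
theorem x_log_x_le_and_le_rpow :
    ∃ α₀ : ℝ, ∀ α : ℝ, α₀ < α →
      ∀ x y z : ℝ,
        x = α / Real.logb 2 α →
        y = Real.logb 2 α / Real.logb 2 (Real.logb 2 α) →
        z = y * (1 + 2 * Real.logb 2 (Real.logb 2 y) / Real.logb 2 y) →
        x * Real.logb 2 x ≤ α ∧ α ≤ y ^ z := by
  refine ⟨2 ^ (16 : ℝ), fun α hα x y z hx hy hz => ?_⟩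
  have hα0 : 0 < α := lt_trans (by positivity) hα
  have hA : 16 ≤ Real.logb 2 α :=
    (Real.le_logb_iff_rpow_le one_lt_two hα0).2 hα.le
  have hαA : (2 : ℝ) ^ Real.logb 2 α = α :=
    Real.rpow_logb two_pos (by norm_num) hα0
  generalize hAdef : Real.logb 2 α = A at *
  have hA0 : 0 < A := by linarith
  have hB : 4 ≤ Real.logb 2 A :=
    (Real.le_logb_iff_rpow_le one_lt_two hA0).2 (by norm_num; exact hA)
  generalize hBdef : Real.logb 2 A = B at *
  have hB0 : 0 < B := by linarith
  have hC := logb_two_le_half hB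
  have hy0 : 0 < y := hy ▸ div_pos hA0 hB0
  have hlogy : Real.logb 2 y = B - Real.logb 2 B := by
    rw [hy, Real.logb_div hA0.ne' hB0.ne', hBdef]
  constructor
  · rw [hx, Real.logb_div hα0.ne' hA0.ne', hAdef, hBdef, div_mul_eq_mul_div,
      div_le_iff₀ hA0]
    nlinarith
  · have hL : B / 2 ≤ Real.logb 2 y := by linarith
    have hL0 : 0 < Real.logb 2 y := by linarith
    have hLL : Real.logb 2 B ≤ 2 * Real.logb 2 (Real.logb 2 y) := by
      have h := Real.logb_le_logb_of_le one_lt_two hB0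
        (show B ≤ Real.logb 2 y ^ 2 by nlinarith)
      rwa [Real.logb_pow, Nat.cast_ofNat] at h
    have hexp : A ≤ Real.logb 2 y * z := by
      have hmul : Real.logb 2 y * z =
          y * (Real.logb 2 y + 2 * Real.logb 2 (Real.logb 2 y)) := by
        rw [hz]
        field_simp
      calc A = y * B := by rw [hy, div_mul_cancel₀ _ hB0.ne']
        _ ≤ Real.logb 2 y * z := by
          rw [hmul]
          exact mul_le_mul_of_nonneg_left (by linarith) hy0.le
    calc α = 2 ^ A := hαA.symm
      _ ≤ 2 ^ (Real.logb 2 y * z) := Real.rpow_le_rpow_of_exponent_le one_le_two hexp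
      _ = y ^ z := by
        rw [Real.rpow_mul two_pos.le, Real.rpow_logb two_pos (by norm_num) hy0]
end

section
/- Let G = (V,E) be a graph and k ≥ 1 an integer. Suppose H₁, …, H_k ⊆ E are pairwise disjoint edge sets such that for each i ∈ {1,…,k} and every cut of G (i.e., every set E(S, V∖S) of edges with exactly one endpoint in S, for ∅ ≠ S ⊊ V): if the cut contains at least one edge of E ∖ (H₁ ∪ … ∪ H_{i−1}), then the cut contains at least one edge of H_i. Then for every cut of G, the set H = H₁ ∪ … ∪ H_k contains either all edges of the cut or at least k edges of the cut. -/
open SimpleGraph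

/-- The cut determined by a vertex set `S`: the set of edges of `G` with exactly one
endpoint in `S`. -/
def cutEdges {V : Type*} (G : SimpleGraph V) (S : Set V) : Set (Sym2 V) :=
  {e | e ∈ G.edgeSet ∧ ∃ u v : V, e = s(u, v) ∧ u ∈ S ∧ v ∉ S}

/-- A graph is `k`-edge-connected if every cut contains at least `k` edges. -/
def EdgeConnected {V : Type*} (G : SimpleGraph V) (k : ℕ) : Prop :=
  ∀ S : Set V, S.Nonempty → S ≠ Set.univ → k ≤ (cutEdges G S).ncard

/-- peeling `k` successive skeletons `H_1, ..., H_k` (each `H_i` meeting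
every cut that still contains an edge outside `H_1 ∪ ... ∪ H_(i-1)`) yields a set `H` that,
for every cut, contains either all of its edges or at least `k` of them. -/
theorem skeleton_peeling {V : Type*} [Fintype V] (G : SimpleGraph V) (k : ℕ) (hk : 1 ≤ k)
    (Hs : Fin k → Set (Sym2 V)) (hsub : ∀ i, Hs i ⊆ G.edgeSet)
    (hdisj : Pairwise fun i j => Disjoint (Hs i) (Hs j))
    (hskel : ∀ i : Fin k, ∀ S : Set V, S.Nonempty → S ≠ Set.univ →
      (cutEdges G S ∩ (G.edgeSet \ ⋃ j < i, Hs j)).Nonempty →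
      (cutEdges G S ∩ Hs i).Nonempty) :
    ∀ S : Set V, S.Nonempty → S ≠ Set.univ →
      cutEdges G S ⊆ (⋃ i, Hs i) ∨ k ≤ (cutEdges G S ∩ ⋃ i, Hs i).ncard := by
  intro S hS hS'
  refine or_iff_not_imp_left.2 fun hnot => ?_
  obtain ⟨e, he, heH⟩ := Set.not_subset.1 hnot
  have hmeet : ∀ i, (cutEdges G S ∩ Hs i).Nonempty := fun i =>
    hskel i S hS hS' ⟨e, he, he.1, fun h => heH (Set.iUnion₂_subset_iUnion _ _ h)⟩
  choose f hf using hmeet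
  have hinj : Function.Injective f := fun i j hij => by
    by_contra hne
    exact Set.disjoint_left.1 (hdisj hne) (hf i).2 (hij ▸ (hf j).2)
  calc k = (Set.range f).ncard := by
        rw [← Set.image_univ, Set.ncard_image_of_injective _ hinj, Set.ncard_univ,
          Nat.card_eq_fintype_card, Fintype.card_fin]
    _ ≤ (cutEdges G S ∩ ⋃ i, Hs i).ncard := Set.ncard_le_ncard
        (Set.range_subset_iff.2 fun i => ⟨(hf i).1, Set.mem_iUnion.2 ⟨i, (hf i).2⟩⟩)
        (Set.toFinite _)
end

section
/- For every graph G = (V,E) on n vertices and every integer k ≥ 1, there exists an edge set H ⊆ E with at most k·(n−1) edges such that every cut of G either has all of its edges in H or has at least k of its edges in H. -/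
open SimpleGraph

namespace SimpleGraph

/-- An acyclic graph on `n` vertices has at most `n - 1` edges. -/
theorem IsAcyclic.ncard_edgeSet_le {V : Type*} [Fintype V] {F : SimpleGraph V}
    (hF : F.IsAcyclic) : F.edgeSet.ncard ≤ Fintype.card V - 1 := by
  classical
  cases isEmpty_or_nonempty V
  · simp [Set.eq_empty_of_isEmpty F.edgeSet]
  obtain ⟨T, hFT, hT⟩ := exists_maximal_isAcyclic_of_le_isAcyclic (le_top : F ≤ ⊤) hF
  have hcard := ((connected_top.maximal_le_isAcyclic_iff_isTree le_top).1 hT).card_edgeFinset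
  have hle := Set.ncard_le_ncard (edgeSet_mono hFT) (Set.toFinite _)
  rw [← coe_edgeFinset T, Set.ncard_coe_finset] at hle
  lia

/-- A cut separating two reachable vertices contains an edge. -/
theorem Reachable.exists_adj_of_mem_of_notMem {V : Type*} {G : SimpleGraph V} {u v : V}
    (h : G.Reachable u v) {S : Set V} (hu : u ∈ S) (hv : v ∉ S) :
    ∃ a ∈ S, ∃ b ∉ S, G.Adj a b := by
  obtain ⟨p⟩ := h
  obtain ⟨d, -, ha, hb⟩ := p.exists_boundary_dart S hu hv
  exact ⟨d.fst, ha, d.snd, hb, d.adj⟩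

end SimpleGraph

/-- every graph on `n` vertices has an edge set `H` with at most
`k·(n-1)` edges such that every cut either has all of its edges in `H` or at least `k` of
its edges in `H`. -/
theorem exists_sparse_certificate {V : Type*} [Fintype V] (G : SimpleGraph V) (k : ℕ)
    (hk : 1 ≤ k) :
    ∃ H ⊆ G.edgeSet, H.ncard ≤ k * (Fintype.card V - 1) ∧
      ∀ S : Set V, S.Nonempty → S ≠ Set.univ →
        cutEdges G S ⊆ H ∨ k ≤ (cutEdges G S ∩ H).ncard := by
  clear hk
  induction k with
  | zero => exact ⟨∅, by simp⟩
  | succ k ih =>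
    obtain ⟨H, hHG, hcard, hcut⟩ := ih
    obtain ⟨F, hFG, hF, hreach⟩ := (G.deleteEdges H).exists_isAcyclic_reachable_eq_le
    have hFG' : F.edgeSet ⊆ G.edgeSet := edgeSet_mono (hFG.trans (G.deleteEdges_le H))
    refine ⟨H ∪ F.edgeSet, Set.union_subset hHG hFG', ?_, fun S hS hS' => ?_⟩
    · have := hF.ncard_edgeSet_le
      have := Set.ncard_union_le H F.edgeSet
      rw [Nat.succ_mul]
      lia
    · by_cases hsub : cutEdges G S ⊆ H
      · exact .inl (hsub.trans Set.subset_union_left)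
      have hle := (hcut S hS hS').resolve_left hsub
      obtain ⟨_, ⟨huv, u, v, rfl, hu, hv⟩, huvH⟩ := Set.not_subset.1 hsub
      have hr : F.Reachable u v := by
        rw [hreach]
        exact (deleteEdges_adj.2 ⟨huv, huvH⟩ : (G.deleteEdges H).Adj u v).reachable
      obtain ⟨a, ha, b, hb, hab⟩ := hr.exists_adj_of_mem_of_notMem hu hv
      have habH : s(a, b) ∉ H := (deleteEdges_adj.1 (hFG hab)).2
      have habG : s(a, b) ∈ cutEdges G S := ⟨hFG' hab, a, b, rfl, ha, hb⟩
      right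
      calc k + 1 ≤ (cutEdges G S ∩ H).ncard + 1 := by lia
        _ = (insert s(a, b) (cutEdges G S ∩ H)).ncard :=
          (Set.ncard_insert_of_notMem (fun h => habH h.2) (Set.toFinite _)).symm
        _ ≤ (cutEdges G S ∩ (H ∪ F.edgeSet)).ncard :=
          Set.ncard_le_ncard (Set.insert_subset ⟨habG, .inr hab⟩
            (Set.inter_subset_inter_right _ Set.subset_union_left)) (Set.toFinite _)
end

section
/- Let G = (V,E) be a k-edge-connected graph, let 0 < ε < 1, let Q ≥ 1 be an integer, and let E = E₁ ∪ … ∪ E_Q be a partition of the edges such that for every cut C of G and every i ∈ {1,…,Q}: |C ∩ E_i| ≥ |C|·(1−ε)/Q and |C ∩ E_i| ≤ |C|·(1+ε)/Q. Set k' = k·(1+ε)/(Q·(1−ε)). Suppose that for each i, H_i ⊆ E_i is an edge set such that every cut of the graph (V, E_i) either has all of its edges in H_i or has at least k' of its edges in H_i. Then H = H₁ ∪ … ∪ H_Q contains at least k edges of every cut of G; in particular, (V, H) is k-edge-connected. -/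
open SimpleGraph

/-- Edges of a cut of `G` that lie in `F` form a part of the same cut of the graph `(V, F)`. -/
theorem cutEdges_inter_subset_cutEdges_fromEdgeSet {V : Type*} (G : SimpleGraph V)
    (F : Set (Sym2 V)) (S : Set V) :
    cutEdges G S ∩ F ⊆ cutEdges (SimpleGraph.fromEdgeSet F) S := by
  rintro e ⟨⟨he, huv⟩, heF⟩
  refine ⟨?_, huv⟩
  rw [SimpleGraph.edgeSet_fromEdgeSet]
  exact ⟨heF, G.not_isDiag_of_mem_edgeSet he⟩

/-- combining certificates of the parts of a random-like edge partition.
If `E = E_1 ∪ ... ∪ E_Q` is a partition in which every cut is split evenly up to a factor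
`1 ± ε`, and each `H_i ⊆ E_i` contains, from every cut of `(V, E_i)`, either all of its
edges or at least `k' = k(1+ε)/(Q(1-ε))` of them, then `H = H_1 ∪ ... ∪ H_Q` contains at
least `k` edges of every cut of `G`; in particular `(V, H)` is `k`-edge-connected. -/
theorem certificate_from_partition {V : Type*} [Fintype V] (G : SimpleGraph V)
    (k Q : ℕ) (hk : 1 ≤ k) (hQ : 1 ≤ Q) (ε : ℝ) (hε0 : 0 < ε) (hε1 : ε < 1)
    (hG : EdgeConnected G k)
    (Es : Fin Q → Set (Sym2 V))
    (hEsub : ∀ i, Es i ⊆ G.edgeSet)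
    (hEdisj : Pairwise fun i j => Disjoint (Es i) (Es j))
    (hEcover : (⋃ i, Es i) = G.edgeSet)
    (hlower : ∀ S : Set V, S.Nonempty → S ≠ Set.univ → ∀ i,
      ((cutEdges G S).ncard : ℝ) * (1 - ε) / Q ≤ ((cutEdges G S ∩ Es i).ncard : ℝ))
    (hupper : ∀ S : Set V, S.Nonempty → S ≠ Set.univ → ∀ i,
      ((cutEdges G S ∩ Es i).ncard : ℝ) ≤ ((cutEdges G S).ncard : ℝ) * (1 + ε) / Q)
    (Hs : Fin Q → Set (Sym2 V)) (hHsub : ∀ i, Hs i ⊆ Es i)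
    (hcert : ∀ i, ∀ S : Set V, S.Nonempty → S ≠ Set.univ →
      cutEdges G S ∩ Es i ⊆ Hs i ∨
      (k : ℝ) * (1 + ε) / (Q * (1 - ε)) ≤ ((cutEdges G S ∩ Hs i).ncard : ℝ)) :
    (∀ S : Set V, S.Nonempty → S ≠ Set.univ →
      k ≤ (cutEdges G S ∩ ⋃ i, Hs i).ncard) ∧
    EdgeConnected (SimpleGraph.fromEdgeSet (⋃ i, Hs i)) k := by
  have hQ0 : (0 : ℝ) < Q := by exact_mod_cast hQ
  have hε : (0 : ℝ) < 1 - ε := by linarith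
  have hcut : ∀ S : Set V, S.Nonempty → S ≠ Set.univ →
      k ≤ (cutEdges G S ∩ ⋃ i, Hs i).ncard := by
    intro S hS hSu
    by_cases hall : ∀ i, cutEdges G S ∩ Es i ⊆ Hs i
    · have hsub : cutEdges G S ⊆ cutEdges G S ∩ ⋃ i, Hs i := by
        intro e he
        have heE : e ∈ ⋃ i, Es i := hEcover ▸ he.1
        obtain ⟨i, hi⟩ := Set.mem_iUnion.mp heE
        exact ⟨he, Set.mem_iUnion.mpr ⟨i, hall i ⟨he, hi⟩⟩⟩
      exact (hG S hS hSu).trans (Set.ncard_le_ncard hsub)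
    · push Not at hall
      obtain ⟨i, hi⟩ := hall
      have hlarge : (k : ℝ) ≤ (cutEdges G S).ncard * (1 - ε) := by
        have hHE : ((cutEdges G S ∩ Hs i).ncard : ℝ) ≤ (cutEdges G S ∩ Es i).ncard := by
          exact_mod_cast Set.ncard_le_ncard (Set.inter_subset_inter_right _ (hHsub i))
        have h := ((hcert i S hS hSu).resolve_left hi).trans (hHE.trans (hupper S hS hSu i))
        rw [div_le_div_iff₀ (by positivity) hQ0] at h
        have hpos : 0 < (1 + ε) * (Q : ℝ) := by positivity
        refine le_of_mul_le_mul_right ?_ hpos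
        linarith
      have hpart : ∀ j, (k : ℝ) / Q ≤ (cutEdges G S ∩ Hs j).ncard := by
        intro j
        rcases hcert j S hS hSu with h | h
        · have hEH : ((cutEdges G S ∩ Es j).ncard : ℝ) ≤ (cutEdges G S ∩ Hs j).ncard := by
            exact_mod_cast Set.ncard_le_ncard (Set.subset_inter Set.inter_subset_left h)
          calc (k : ℝ) / Q ≤ (cutEdges G S).ncard * (1 - ε) / Q := by gcongr
            _ ≤ _ := (hlower S hS hSu j).trans hEH
        · refine le_trans ?_ h
          rw [div_le_div_iff₀ hQ0 (by positivity)]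
          have : 0 ≤ (k : ℝ) * Q * ε := by positivity
          linarith
      have hsum : (k : ℝ) ≤ ∑ j, ((cutEdges G S ∩ Hs j).ncard : ℝ) := by
        calc (k : ℝ) = ∑ _j : Fin Q, (k : ℝ) / Q := by
              simp [mul_div_cancel₀ _ hQ0.ne']
          _ ≤ _ := Finset.sum_le_sum fun j _ => hpart j
      rw [Set.inter_iUnion, Set.ncard_iUnion_of_finite fun _ => Set.toFinite _,
        finsum_eq_sum_of_fintype]
      · exact_mod_cast hsum
      · exact fun i j hij => (hEdisj hij).mono (Set.inter_subset_right.trans (hHsub i))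
          (Set.inter_subset_right.trans (hHsub j))
  exact ⟨hcut, fun S hS hSu => (hcut S hS hSu).trans
    (Set.ncard_le_ncard (cutEdges_inter_subset_cutEdges_fromEdgeSet G _ S))⟩
end

section
/- Let G be an unweighted graph on n vertices, let t ≥ 1 be an integer, and let 𝒞 be a collection of pairwise disjoint nonempty vertex sets (clusters) such that any two distinct clusters are at distance at least 10t in G. For a cluster C and j ≥ 0, let C^{+j} = {u ∈ V(G) : d_G(u,C) ≤ j}. Call a cluster C bad if for every j ∈ {0,1,…,4t−1}, the number of vertices outside C^{+j} that are adjacent to C^{+j} is strictly greater than |C|/t. Then the total number of vertices contained in bad clusters is at most n/5. -/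
open SimpleGraph

/-- The set `C⁺ʲ` of vertices at hop distance at most `j` from the set `C`. -/
noncomputable def ballSet {V : Type*} (G : SimpleGraph V) (C : Set V) (j : ℕ) : Set V :=
  {u | ∃ v ∈ C, wdist G (fun _ => 1) u v ≤ (j : ENNReal)}

/-- A cluster `C` is bad (for the parameter `t`) if for every `j ∈ {0, …, 4t-1}` the
number of vertices outside `C⁺ʲ` adjacent to `C⁺ʲ` exceeds `|C|/t`. -/
noncomputable def IsBadCluster {V : Type*} (G : SimpleGraph V) (t : ℕ) (C : Set V) : Prop :=
  ∀ j < 4 * t, (C.ncard : ℝ) / t <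
    (({u | u ∉ ballSet G C j ∧ ∃ x ∈ ballSet G C j, G.Adj u x}).ncard : ℝ)

theorem sum_map_one_edges {V : Type*} {G : SimpleGraph V} {u v : V} (p : G.Walk u v) :
    (((p.edges.map fun _ => (1 : NNReal)).sum : NNReal) : ENNReal) = (p.length : ENNReal) := by
  simp

theorem wdist_one_le_length {V : Type*} {G : SimpleGraph V} {u v : V} (p : G.Walk u v) :
    wdist G (fun _ => 1) u v ≤ (p.length : ENNReal) :=
  (iInf_le _ p).trans (sum_map_one_edges p).le

theorem wdist_one_le_natCast_iff {V : Type*} {G : SimpleGraph V} {u v : V} {j : ℕ} :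
    wdist G (fun _ => 1) u v ≤ (j : ENNReal) ↔ ∃ p : G.Walk u v, p.length ≤ j := by
  refine ⟨fun h => ?_, fun ⟨p, hp⟩ => (wdist_one_le_length p).trans (by exact_mod_cast hp)⟩
  have hlt : wdist G (fun _ => 1) u v < ((j + 1 : ℕ) : ENNReal) :=
    h.trans_lt (by exact_mod_cast Nat.lt_succ_self j)
  obtain ⟨p, hp⟩ := iInf_lt_iff.1 hlt
  rw [sum_map_one_edges] at hp
  exact ⟨p, Nat.lt_succ_iff.1 (by exact_mod_cast hp)⟩

theorem mem_ballSet_iff {V : Type*} {G : SimpleGraph V} {C : Set V} {j : ℕ} {u : V} :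
    u ∈ ballSet G C j ↔ ∃ v ∈ C, ∃ p : G.Walk u v, p.length ≤ j := by
  simp only [ballSet, Set.mem_ofPred_eq, wdist_one_le_natCast_iff]

theorem subset_ballSet {V : Type*} (G : SimpleGraph V) (C : Set V) (j : ℕ) :
    C ⊆ ballSet G C j :=
  fun u hu => mem_ballSet_iff.2 ⟨u, hu, Walk.nil, by simp⟩

theorem ballSet_mono {V : Type*} (G : SimpleGraph V) (C : Set V) : Monotone (ballSet G C) := by
  intro i j hij u hu
  obtain ⟨v, hv, p, hp⟩ := mem_ballSet_iff.1 hu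
  exact mem_ballSet_iff.2 ⟨v, hv, p, hp.trans hij⟩

theorem mem_ballSet_succ_of_adj {V : Type*} {G : SimpleGraph V} {C : Set V} {j : ℕ} {u x : V}
    (hx : x ∈ ballSet G C j) (h : G.Adj u x) : u ∈ ballSet G C (j + 1) := by
  obtain ⟨v, hv, p, hp⟩ := mem_ballSet_iff.1 hx
  exact mem_ballSet_iff.2 ⟨v, hv, Walk.cons h p, by simpa using hp⟩

theorem ncard_ballSet_add_ncard_boundary_le {V : Type*} [Finite V] (G : SimpleGraph V)
    (C : Set V) (j : ℕ) :
    (ballSet G C j).ncard + {u | u ∉ ballSet G C j ∧ ∃ x ∈ ballSet G C j, G.Adj u x}.ncard ≤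
      (ballSet G C (j + 1)).ncard := by
  rw [← Set.ncard_union_eq (Set.disjoint_left.2 fun u hu hu' => hu'.1 hu)]
  refine Set.ncard_le_ncard (Set.union_subset (ballSet_mono G C j.le_succ) ?_)
  rintro u ⟨-, x, hx, hux⟩
  exact mem_ballSet_succ_of_adj hx hux

theorem IsBadCluster.le_ncard_ballSet {V : Type*} [Finite V] {G : SimpleGraph V} {t : ℕ}
    {C : Set V} (hC : IsBadCluster G t C) {j : ℕ} (hj : j ≤ 4 * t) :
    (C.ncard : ℝ) + j * (C.ncard / t) ≤ (ballSet G C j).ncard := by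
  induction j with
  | zero => simpa using Set.ncard_le_ncard (subset_ballSet G C 0)
  | succ j ih =>
    have hle : ((ballSet G C j).ncard : ℝ) +
        {u | u ∉ ballSet G C j ∧ ∃ x ∈ ballSet G C j, G.Adj u x}.ncard ≤
          (ballSet G C (j + 1)).ncard := by
      exact_mod_cast ncard_ballSet_add_ncard_boundary_le G C j
    have hlt := hC j hj
    have hih := ih (by omega)
    push_cast
    linarith

theorem IsBadCluster.five_mul_ncard_le {V : Type*} [Finite V] {G : SimpleGraph V} {t : ℕ}
    (ht : 1 ≤ t) {C : Set V} (hC : IsBadCluster G t C) :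
    5 * C.ncard ≤ (ballSet G C (4 * t)).ncard := by
  have h := hC.le_ncard_ballSet le_rfl
  have ht' : (t : ℝ) ≠ 0 := by exact_mod_cast (by omega : t ≠ 0)
  have heq : (C.ncard : ℝ) + ((4 * t : ℕ) : ℝ) * (C.ncard / t) = 5 * C.ncard := by
    push_cast
    field_simp
    ring
  rw [heq] at h
  exact_mod_cast h

theorem disjoint_ballSet {V : Type*} {G : SimpleGraph V} {C D : Set V} {i j k : ℕ}
    (hk : i + j < k) (hsep : ∀ u ∈ C, ∀ v ∈ D, (k : ENNReal) ≤ wdist G (fun _ => 1) u v) :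
    Disjoint (ballSet G C i) (ballSet G D j) := by
  refine Set.disjoint_left.2 fun x hxC hxD => ?_
  obtain ⟨u, hu, p, hp⟩ := mem_ballSet_iff.1 hxC
  obtain ⟨v, hv, q, hq⟩ := mem_ballSet_iff.1 hxD
  have h := (hsep u hu v hv).trans (wdist_one_le_length (p.reverse.append q))
  rw [Walk.length_append, Walk.length_reverse] at h
  have h' : k ≤ p.length + q.length := by exact_mod_cast h
  omega

theorem mul_ncard_biUnion_le {V : Type*} [Finite V] {k : ℕ} (S : Set (Set V))
    (B : Set V → Set V) (hB : S.PairwiseDisjoint B)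
    (hk : ∀ C ∈ S, k * C.ncard ≤ (B C).ncard) :
    k * (⋃ C ∈ S, C).ncard ≤ Nat.card V := by
  classical
  have := Fintype.ofFinite V
  calc k * (⋃ C ∈ S, C).ncard
      = k * (S.toFinset.biUnion fun C => C.toFinset).card := by
        rw [← Set.ncard_coe_finset]
        simp
    _ ≤ k * ∑ C ∈ S.toFinset, C.toFinset.card :=
        Nat.mul_le_mul_left _ Finset.card_biUnion_le
    _ = ∑ C ∈ S.toFinset, k * C.toFinset.card := Finset.mul_sum _ _ _
    _ ≤ ∑ C ∈ S.toFinset, (B C).toFinset.card := by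
        refine Finset.sum_le_sum fun C hC => ?_
        simpa only [Set.ncard_eq_toFinset_card'] using hk C (Set.mem_toFinset.1 hC)
    _ = (S.toFinset.biUnion fun C => (B C).toFinset).card := by
        refine (Finset.card_biUnion fun C hC D hD hCD => ?_).symm
        exact Set.disjoint_toFinset.2 (hB (Set.mem_toFinset.1 hC) (Set.mem_toFinset.1 hD) hCD)
    _ ≤ Nat.card V := by
        rw [Nat.card_eq_fintype_card]
        exact Finset.card_le_univ _

/-- in a `10t`-separated clustering of an `n`-vertex graph, the bad
clusters (those that keep expanding by more than a `1/t` fraction for `4t` steps) contain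
at most `n/5` vertices in total. -/
theorem bad_clusters_small {n : ℕ} (G : SimpleGraph (Fin n)) (t : ℕ) (ht : 1 ≤ t)
    (𝒞 : Set (Set (Fin n)))
    (hne : ∀ C ∈ 𝒞, C.Nonempty)
    (hdisj : 𝒞.Pairwise fun C₁ C₂ => Disjoint C₁ C₂)
    (hsep : ∀ C₁ ∈ 𝒞, ∀ C₂ ∈ 𝒞, C₁ ≠ C₂ → ∀ u ∈ C₁, ∀ v ∈ C₂,
      ((10 * t : ℕ) : ENNReal) ≤ wdist G (fun _ => 1) u v) :
    ((⋃ C ∈ {C ∈ 𝒞 | IsBadCluster G t C}, C).ncard : ℝ) ≤ (n : ℝ) / 5 := by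
  have h : 5 * (⋃ C ∈ {C ∈ 𝒞 | IsBadCluster G t C}, C).ncard ≤ n := by
    simpa using mul_ncard_biUnion_le {C ∈ 𝒞 | IsBadCluster G t C}
      (fun C => ballSet G C (4 * t))
      (fun C hC D hD hCD => disjoint_ballSet (by omega) (hsep C hC.1 D hD.1 hCD))
      (fun C hC => hC.2.five_mul_ncard_le ht)
  have h' : (5 : ℝ) * (⋃ C ∈ {C ∈ 𝒞 | IsBadCluster G t C}, C).ncard ≤ n := by exact_mod_cast h
  linarith
end
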